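/- arXiv:2303.11248 — 2 statements merged into one kernel-verified Lean document; each statement's English description precedes it below -/
import Mathlib

section
/- Let φ be a rational inner function on the polydisk 𝔻^d and let α ∈ 𝕋. Then the Clark measure σ_α is singular with respect to Lebesgue measure on 𝕋^d. -/
open MeasureTheory Complex Filter Topology

noncomputable section

/-- The open unit polydisk `𝔻^d` in `ℂ^d`. -/
def polyDisk (d : ℕ) : Set (Fin d → ℂ) := {z | ∀ j, ‖z j‖ < 1}

/-- The distinguished boundary `𝕋^d` of the polydisk. -/
def polyTorus (d : ℕ) : Set (Fin d → ℂ) := {z | ∀ j, ‖z j‖ = 1}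

/-- The product Poisson kernel `P_z(ζ) = ∏_j (1-|z_j|²)/|ζ_j - z_j|²`. -/
def poissonD (d : ℕ) (z ζ : Fin d → ℂ) : ℝ :=
  ∏ j, (1 - ‖z j‖ ^ 2) / ‖ζ j - z j‖ ^ 2

/-- `φ` has radial limit `L` at `ζ`:  `φ(rζ) → L` as `r → 1⁻`. -/
def HasRadialLimit (d : ℕ) (φ : (Fin d → ℂ) → ℂ) (ζ : Fin d → ℂ) (L : ℂ) : Prop :=
  Tendsto (fun r : ℝ => φ (fun j => (r : ℂ) * ζ j)) (𝓝[<] (1 : ℝ)) (𝓝 L)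

/-- Normalized Lebesgue measure on the d-torus, as a measure on `ℂ^d`. -/
def torusLebesgue (d : ℕ) : Measure (Fin d → ℂ) :=
  (ENNReal.ofReal ((2 * Real.pi) ^ d))⁻¹ •
    Measure.map (fun θ : Fin d → ℝ => fun j => Complex.exp ((θ j : ℂ) * Complex.I))
      (MeasureTheory.volume.restrict (Set.pi Set.univ fun _ => Set.Ico 0 (2 * Real.pi)))

/-- `φ = q/p` is a rational inner function on `𝔻^d`: `p, q` have no common factor,
`p` is zero-free on the polydisk, `φ` maps `𝔻^d` to `𝔻`, and the radial limits of `φ`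
are unimodular a.e. on `𝕋^d`. -/
structure IsRIFd (d : ℕ) (p q : MvPolynomial (Fin d) ℂ) : Prop where
  coprime : ∀ r : MvPolynomial (Fin d) ℂ, r ∣ p → r ∣ q → IsUnit r
  stable : ∀ z ∈ polyDisk d, MvPolynomial.eval z p ≠ 0
  mapsToDisk : ∀ z ∈ polyDisk d,
    ‖MvPolynomial.eval z q / MvPolynomial.eval z p‖ < 1
  inner : ∀ᵐ ζ ∂(torusLebesgue d),
    ∃ L : ℂ, ‖L‖ = 1 ∧
      HasRadialLimit d (fun z => MvPolynomial.eval z q / MvPolynomial.eval z p) ζ L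

/-- `σ` is the Clark measure of `φ` at parameter `α`: a positive Borel measure on `𝕋^d`
whose Poisson integral is `(1-|φ(z)|²)/|α-φ(z)|²`. -/
def IsClarkMeasureD (d : ℕ) (φ : (Fin d → ℂ) → ℂ) (α : ℂ) (σ : Measure (Fin d → ℂ)) : Prop :=
  σ (polyTorus d)ᶜ = 0 ∧
  ∀ z ∈ polyDisk d,
    ∫⁻ ζ, ENNReal.ofReal (poissonD d z ζ) ∂σ =
      ENNReal.ofReal ((1 - ‖φ z‖ ^ 2) / ‖α - φ z‖ ^ 2)

/-- The unimodular level set `C_α(φ)`. -/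
def levelSetD (d : ℕ) (φ : (Fin d → ℂ) → ℂ) (α : ℂ) : Set (Fin d → ℂ) :=
  closure {ζ | ζ ∈ polyTorus d ∧ HasRadialLimit d φ ζ α}

/-- The topological support of a measure: points all of whose open neighborhoods
have positive measure. -/
def measureSupport {X : Type*} [TopologicalSpace X] [MeasurableSpace X]
    (μ : Measure X) : Set X :=
  {x | ∀ U : Set X, IsOpen U → x ∈ U → 0 < μ U}

/-- One-dimensional arc-length measure on the circle, in `ℂ`. -/
def circNu : Measure ℂ :=
  Measure.map (fun t : ℝ => Complex.exp ((t : ℂ) * Complex.I))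
    (volume.restrict (Set.Ico 0 (2 * Real.pi)))

lemma circ_meas : Measurable (fun t : ℝ => Complex.exp ((t : ℂ) * Complex.I)) := by
  fun_prop

instance circNu_finite : IsFiniteMeasure circNu := by
  unfold circNu; infer_instance

lemma circ_surj (w : ℂ) (hw : ‖w‖ = 1) :
    ∃ t ∈ Set.Ico (0:ℝ) (2 * Real.pi), Complex.exp ((t : ℂ) * Complex.I) = w := by
  refine ⟨toIcoMod Real.two_pi_pos 0 (Complex.arg w), ?_, ?_⟩
  · simpa using toIcoMod_mem_Ico Real.two_pi_pos 0 (Complex.arg w)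
  · have h1 : Complex.exp ((Complex.arg w : ℂ) * Complex.I) = w := by
      have := Complex.norm_mul_exp_arg_mul_I w
      rwa [hw, Complex.ofReal_one, one_mul] at this
    have hp : Function.Periodic (fun t : ℝ => Complex.exp ((t : ℂ) * Complex.I))
        (2 * Real.pi) := by
      intro t
      have := Complex.exp_mul_I_periodic (t : ℂ)
      simpa using this
    rw [← self_sub_toIcoDiv_zsmul]
    exact (hp.sub_zsmul_eq _).trans h1

lemma circ_lip (s t : ℝ) :
    ‖Complex.exp ((s : ℂ) * Complex.I) - Complex.exp ((t : ℂ) * Complex.I)‖ ≤ |s - t| := by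
  have h : Complex.exp ((s : ℂ) * Complex.I) - Complex.exp ((t : ℂ) * Complex.I)
      = Complex.exp ((t : ℂ) * Complex.I) *
        (Complex.exp (Complex.I * ((s - t : ℝ) : ℂ)) - 1) := by
    rw [mul_sub, ← Complex.exp_add, mul_one]
    congr 2
    push_cast; ring
  rw [h, norm_mul, Complex.norm_exp_ofReal_mul_I, one_mul]
  exact Real.norm_exp_I_mul_ofReal_sub_one_le

lemma circNu_atoms : NullSingletonClass circNu := by
  refine ⟨fun w => ?_⟩
  rw [circNu, Measure.map_apply circ_meas (measurableSet_singleton w)]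
  refine measure_mono_null (Set.Subset.rfl) ?_
  rw [Measure.restrict_apply (circ_meas (measurableSet_singleton w))]
  refine Set.Subsingleton.measure_zero ?_ _
  rintro a ⟨ha, ha'⟩ b ⟨hb, hb'⟩
  have hab : Complex.exp ((a : ℂ) * Complex.I) = Complex.exp ((b : ℂ) * Complex.I) := by
    have h1 : Complex.exp ((a : ℂ) * Complex.I) = w := ha
    have h2 : Complex.exp ((b : ℂ) * Complex.I) = w := hb
    rw [h1, h2]
  obtain ⟨n, hn⟩ := Complex.exp_eq_exp_iff_exists_int.1 hab
  have hn' : (a : ℂ) = ((b + n * (2 * Real.pi) : ℝ) : ℂ) := by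
    apply mul_right_cancel₀ Complex.I_ne_zero
    rw [hn]; push_cast; ring
  have hn2 : a = b + n * (2 * Real.pi) := by exact_mod_cast hn'
  have hpi := Real.two_pi_pos
  have h1 : (n : ℝ) < 1 := by
    by_contra hc
    push Not at hc
    nlinarith [ha'.2, hb'.1]
  have h2 : (-1 : ℝ) < n := by
    by_contra hc
    push Not at hc
    nlinarith [ha'.1, hb'.2]
  have h3 : n = 0 := by
    have h1' : n < 1 := by exact_mod_cast h1
    have h2' : -1 < n := by exact_mod_cast h2
    omega
  rw [hn2, h3]; simp

lemma circNu_ball (w : ℂ) (hw : ‖w‖ = 1) (δ : ℝ) (h0 : 0 < δ) (h1 : δ < 1) :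
    ENNReal.ofReal δ ≤ circNu (Metric.closedBall w δ) := by
  obtain ⟨t, ht, rfl⟩ := circ_surj w hw
  have hpi := Real.pi_gt_three
  rw [circNu, Measure.map_apply circ_meas Metric.isClosed_closedBall.measurableSet,
    Measure.restrict_apply (circ_meas Metric.isClosed_closedBall.measurableSet)]
  have key : ∀ s : ℝ, |s - t| ≤ δ → s ∈ (fun t : ℝ => Complex.exp ((t : ℂ) * Complex.I)) ⁻¹'
      Metric.closedBall (Complex.exp ((t : ℂ) * Complex.I)) δ := by
    intro s hs
    simp only [Set.mem_preimage, Metric.mem_closedBall, dist_eq_norm]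
    exact (circ_lip s t).trans hs
  rcases le_total t Real.pi with hc | hc
  · calc ENNReal.ofReal δ = volume (Set.Icc t (t + δ)) := by rw [Real.volume_Icc]; congr 1; ring
      _ ≤ _ := by
        apply measure_mono
        rintro s ⟨hs1, hs2⟩
        refine ⟨key s (abs_le.2 ⟨by linarith, by linarith⟩), by linarith [ht.1], by linarith⟩
  · calc ENNReal.ofReal δ = volume (Set.Icc (t - δ) t) := by rw [Real.volume_Icc]; congr 1; ring
      _ ≤ _ := by
        apply measure_mono
        rintro s ⟨hs1, hs2⟩
        refine ⟨key s (abs_le.2 ⟨by linarith, by linarith⟩), by linarith, by linarith [ht.2]⟩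

lemma torus_eq (d : ℕ) : torusLebesgue d =
    (ENNReal.ofReal ((2 * Real.pi) ^ d))⁻¹ • Measure.pi (fun _ : Fin d => circNu) := by
  unfold torusLebesgue
  congr 1
  rw [volume_pi, Measure.restrict_pi_pi]
  have : ∀ i : Fin d, SigmaFinite (Measure.map (fun t : ℝ => Complex.exp ((t : ℂ) * Complex.I))
    (volume.restrict (Set.Ico 0 (2 * Real.pi)))) := fun _ => by
      change SigmaFinite circNu; infer_instance
  exact Measure.pi_map_pi (μ := fun _ : Fin d => volume.restrict (Set.Ico 0 (2 * Real.pi)))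
    (f := fun _ t => Complex.exp ((t : ℂ) * Complex.I)) (fun i => circ_meas.aemeasurable)

lemma poly_null (ν : Measure ℂ) [IsFiniteMeasure ν] [NullSingletonClass ν] : ∀ (d : ℕ)
    (f : MvPolynomial (Fin d) ℂ), f ≠ 0 →
    Measure.pi (fun _ : Fin d => ν) {z | MvPolynomial.eval z f = 0} = 0 := by
  intro d
  induction d with
  | zero =>
    intro f hf
    have : {z : Fin 0 → ℂ | MvPolynomial.eval z f = 0} = ∅ := by
      ext z
      simp only [Set.mem_ofPred_eq, Set.mem_empty_iff_false, iff_false]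
      intro h
      apply hf
      apply MvPolynomial.funext
      intro x
      rw [Subsingleton.elim x z, h, map_zero]
    rw [this, measure_empty]
  | succ n ih =>
    intro f hf
    have hmp := (measurePreserving_piFinSuccAbove (fun _ : Fin (n+1) => ν) 0).symm
    have hS : MeasurableSet {z : Fin (n+1) → ℂ | MvPolynomial.eval z f = 0} :=
      (isClosed_eq (MvPolynomial.continuous_eval f) continuous_const).measurableSet
    rw [← hmp.measure_preimage hS.nullMeasurableSet]
    have hF : MvPolynomial.finSuccEquiv ℂ n f ≠ 0 := by
      simpa using hf
    have hS' := hmp.measurable hS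
    rw [Measure.prod_apply_symm hS', lintegral_eq_zero_iff (measurable_measure_prodMk_right hS')]
    have hlc : (MvPolynomial.finSuccEquiv ℂ n f).leadingCoeff ≠ 0 := by
      simpa using hF
    have hae : ∀ᵐ s ∂(Measure.pi (fun _ : Fin n => ν)),
        MvPolynomial.eval s (MvPolynomial.finSuccEquiv ℂ n f).leadingCoeff ≠ 0 := by
      rw [ae_iff]
      simpa using ih _ hlc
    filter_upwards [hae] with s hs
    have hne : Polynomial.map (MvPolynomial.eval s) (MvPolynomial.finSuccEquiv ℂ n f) ≠ 0 := by
      intro h0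
      apply hs
      have := congrArg (fun P => Polynomial.coeff P
        (MvPolynomial.finSuccEquiv ℂ n f).natDegree) h0
      simpa [Polynomial.coeff_map] using this
    refine Set.Finite.measure_zero ?_ ν
    refine (Polynomial.finite_setOfPred_isRoot hne).subset ?_
    intro y hy
    have hy' : MvPolynomial.eval (Fin.cons y s : Fin (n+1) → ℂ) f = 0 := by
      simpa [MeasurableEquiv.piFinSuccAbove, Fin.insertNthEquiv] using hy
    rw [MvPolynomial.eval_eq_eval_mv_eval'] at hy'
    exact hy'

lemma torus_null (d : ℕ) (f : MvPolynomial (Fin d) ℂ) (hf : f ≠ 0) :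
    ∀ᵐ z ∂(torusLebesgue d), MvPolynomial.eval z f ≠ 0 := by
  rw [torus_eq]
  apply Measure.ae_smul_measure
  rw [ae_iff]
  have := circNu_atoms
  simpa using poly_null circNu d f hf

lemma torus_mem (d : ℕ) : ∀ᵐ z ∂(torusLebesgue d), z ∈ polyTorus d := by
  unfold torusLebesgue
  apply Measure.ae_smul_measure
  have hm : Measurable (fun θ : Fin d → ℝ => fun j => Complex.exp ((θ j : ℂ) * Complex.I)) := by
    fun_prop
  have hT : MeasurableSet (polyTorus d) := by
    have : polyTorus d = ⋂ j, {z | ‖z j‖ = 1} := by ext; simp [polyTorus]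
    rw [this]
    exact MeasurableSet.iInter fun j =>
      (isClosed_eq (by fun_prop) continuous_const).measurableSet
  refine (ae_map_iff hm.aemeasurable hT).2 ?_
  exact Eventually.of_forall fun θ j => Complex.norm_exp_ofReal_mul_I _

lemma torus_ball (d : ℕ) (z : Fin d → ℂ) (hz : z ∈ polyTorus d) (δ : ℝ) (h0 : 0 < δ)
    (h1 : δ < 1) : (ENNReal.ofReal ((2 * Real.pi) ^ d))⁻¹ * ENNReal.ofReal (δ ^ d) ≤
      torusLebesgue d (Metric.closedBall z δ) := by
  rw [torus_eq, Measure.smul_apply, smul_eq_mul]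
  gcongr
  rw [closedBall_pi _ h0.le, Measure.pi_pi, ENNReal.ofReal_pow h0.le]
  calc ENNReal.ofReal δ ^ d = ∏ _i : Fin d, ENNReal.ofReal δ := by simp
    _ ≤ _ := Finset.prod_le_prod' fun i _ => circNu_ball _ (hz i) δ h0 h1

lemma torus_finite (d : ℕ) : IsFiniteMeasure (torusLebesgue d) := by
  rw [torus_eq]
  have : (ENNReal.ofReal ((2 * Real.pi) ^ d))⁻¹ ≠ ⊤ := by
    simp [Real.pi_pos]
  exact Measure.smul_finite _ this

lemma poisson_lower (d : ℕ) (z η : Fin d → ℂ) (hz : z ∈ polyTorus d) (hη : η ∈ polyTorus d)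
    (δ : ℝ) (h0 : 0 < δ) (h1 : δ < 1) (hb : η ∈ Metric.closedBall z δ) :
    1 ≤ (4 * δ) ^ d * poissonD d (fun j => ((1 - δ : ℝ) : ℂ) * z j) η := by
  unfold poissonD
  have : (4 * δ) ^ d = ∏ _i : Fin d, (4 * δ) := by simp
  rw [this, ← Finset.prod_mul_distrib]
  have hr : 0 < 1 - δ := by linarith
  suffices H : ∀ j : Fin d, 1 ≤ 4 * δ * ((1 - ‖((1 - δ : ℝ) : ℂ) * z j‖ ^ 2) /
      ‖η j - ((1 - δ : ℝ) : ℂ) * z j‖ ^ 2) by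
    have h2 := Finset.prod_le_prod (s := Finset.univ) (f := fun _ : Fin d => (1:ℝ))
      (fun _ _ => zero_le_one) (fun j _ => H j)
    simpa using h2
  intro j
  have hn : ‖((1 - δ : ℝ) : ℂ) * z j‖ = 1 - δ := by
    rw [norm_mul, hz j, mul_one, Complex.norm_real, Real.norm_of_nonneg hr.le]
  rw [hn]
  have hd1 : ‖η j - z j‖ ≤ δ := by
    rw [← dist_eq_norm]
    exact (dist_le_pi_dist η z j).trans hb
  have hup : ‖η j - ((1 - δ : ℝ) : ℂ) * z j‖ ≤ 2 * δ := by
    have e : η j - ((1 - δ : ℝ) : ℂ) * z j = (η j - z j) + (δ : ℂ) * z j := by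
      push_cast; ring
    rw [e]
    refine (norm_add_le _ _).trans ?_
    rw [norm_mul, hz j, mul_one, Complex.norm_real, Real.norm_of_nonneg h0.le]
    linarith
  have hlo : 0 < ‖η j - ((1 - δ : ℝ) : ℂ) * z j‖ := by
    have := norm_sub_norm_le (η j) (((1 - δ : ℝ) : ℂ) * z j)
    rw [hn, hη j] at this
    linarith
  rw [mul_div_assoc', le_div_iff₀ (by positivity), one_mul]
  have : ‖η j - ((1 - δ : ℝ) : ℂ) * z j‖ ^ 2 ≤ (2 * δ) ^ 2 := by gcongr
  nlinarith

lemma clark_ball (d : ℕ) (φ : (Fin d → ℂ) → ℂ) (α : ℂ) (σ : Measure (Fin d → ℂ))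
    (hσ : IsClarkMeasureD d φ α σ) (z : Fin d → ℂ) (hz : z ∈ polyTorus d)
    (δ : ℝ) (h0 : 0 < δ) (h1 : δ < 1) :
    σ (Metric.closedBall z δ) ≤ ENNReal.ofReal ((4 * δ) ^ d) *
      ENNReal.ofReal ((1 - ‖φ (fun j => ((1 - δ : ℝ) : ℂ) * z j)‖ ^ 2) /
        ‖α - φ (fun j => ((1 - δ : ℝ) : ℂ) * z j)‖ ^ 2) := by
  have hr : 0 < 1 - δ := by linarith
  have hmem : (fun j => ((1 - δ : ℝ) : ℂ) * z j) ∈ polyDisk d := by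
    intro j
    rw [norm_mul, hz j, mul_one, Complex.norm_real, Real.norm_of_nonneg hr.le]
    linarith
  rw [← hσ.2 _ hmem, ← lintegral_const_mul' _ _ ENNReal.ofReal_ne_top,
    ← lintegral_indicator_one Metric.isClosed_closedBall.measurableSet]
  have hT : ∀ᵐ η ∂σ, η ∈ polyTorus d := hσ.1
  refine lintegral_mono_ae ?_
  filter_upwards [hT] with η hη
  by_cases hb : η ∈ Metric.closedBall z δ
  · rw [Set.indicator_of_mem hb, ← ENNReal.ofReal_mul (by positivity)]
    simpa using ENNReal.ofReal_le_ofReal (poisson_lower d z η hz hη δ h0 h1 hb)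
  · rw [Set.indicator_of_notMem hb]; exact zero_le

lemma clark_finite (d : ℕ) (φ : (Fin d → ℂ) → ℂ) (α : ℂ) (σ : Measure (Fin d → ℂ))
    (hσ : IsClarkMeasureD d φ α σ) : IsFiniteMeasure σ := by
  refine ⟨?_⟩
  have h := hσ.2 0 (fun j => by simp)
  have hT : ∀ᵐ η ∂σ, η ∈ polyTorus d := hσ.1
  have e : ∫⁻ ζ, ENNReal.ofReal (poissonD d 0 ζ) ∂σ = ∫⁻ _, 1 ∂σ := by
    apply lintegral_congr_ae
    filter_upwards [hT] with η hη
    have : ∀ j, ‖η j‖ = 1 := hη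
    simp [poissonD, this]
  rw [e, lintegral_one] at h
  rw [h]
  exact ENNReal.ofReal_lt_top

lemma clark_aux
    (d : ℕ) (p q : MvPolynomial (Fin d) ℂ)
    (hRIF : IsRIFd d p q) (α : ℂ) (hα : ‖α‖ = 1)
    (σ : Measure (Fin d → ℂ))
    (hσ : IsClarkMeasureD d (fun z => MvPolynomial.eval z q / MvPolynomial.eval z p) α σ) :
    σ.MutuallySingular (torusLebesgue d) := by
  have hI1 : IsFiniteMeasure (torusLebesgue d) := torus_finite d
  have hI2 : IsFiniteMeasure σ := clark_finite d _ α σ hσ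
  have hf : q - MvPolynomial.C α * p ≠ 0 := by
    intro h
    have h0 : (0 : Fin d → ℂ) ∈ polyDisk d := fun j => by simp
    have h1 := hRIF.mapsToDisk 0 h0
    have h2 := congrArg (MvPolynomial.eval (0 : Fin d → ℂ)) h
    simp only [map_sub, map_mul, MvPolynomial.eval_C, map_zero] at h2
    rw [sub_eq_zero.1 h2, mul_div_cancel_right₀ _ (hRIF.stable 0 h0), hα] at h1
    exact lt_irrefl _ h1
  have hI3 : σ.HaveLebesgueDecomposition (torusLebesgue d) :=
    Measure.haveLebesgueDecomposition_of_sigmaFinite _ _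
  rw [← Measure.rnDeriv_eq_zero]
  filter_upwards [Besicovitch.ae_tendsto_rnDeriv σ (torusLebesgue d), hRIF.inner,
    torus_null d _ hf, torus_mem d] with z hz1 hz2 hz3 hz4
  obtain ⟨L, hL, hlim⟩ := hz2
  unfold HasRadialLimit at hlim
  -- the radial limit differs from `α`
  have hLα : L ≠ α := by
    rintro rfl
    apply hz3
    have hc : Continuous (fun r : ℝ => (fun j => (r : ℂ) * z j : Fin d → ℂ)) := by fun_prop
    have hcf : ∀ f : MvPolynomial (Fin d) ℂ,
        Tendsto (fun r : ℝ => MvPolynomial.eval (fun j => (r : ℂ) * z j) f) (𝓝[<] (1 : ℝ))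
          (𝓝 (MvPolynomial.eval z f)) := by
      intro f
      have := ((MvPolynomial.continuous_eval f).comp hc).tendsto 1
      simp only [Function.comp_def, Complex.ofReal_one, one_mul] at this
      exact this.mono_left nhdsWithin_le_nhds
    have hq := hlim.mul (hcf p)
    have hq2 : Tendsto (fun r : ℝ => MvPolynomial.eval (fun j => (r : ℂ) * z j) q)
        (𝓝[<] (1 : ℝ)) (𝓝 (L * MvPolynomial.eval z p)) := by
      refine hq.congr' ?_
      filter_upwards [Ioo_mem_nhdsLT (show (0:ℝ) < 1 by norm_num)] with r hr
      refine div_mul_cancel₀ _ (hRIF.stable _ fun j => ?_)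
      rw [norm_mul, hz4 j, mul_one, Complex.norm_real, Real.norm_of_nonneg hr.1.le]
      exact hr.2
    have := tendsto_nhds_unique (hcf q) hq2
    simp [this]
  have hshift : Tendsto (fun δ : ℝ => 1 - δ) (𝓝[>] 0) (𝓝[<] 1) := by
    refine tendsto_nhdsWithin_iff.2 ⟨?_, ?_⟩
    · have : Tendsto (fun δ : ℝ => 1 - δ) (𝓝 0) (𝓝 (1 - 0)) :=
        (continuous_const.sub continuous_id).tendsto 0
      rw [sub_zero] at this
      exact this.mono_left nhdsWithin_le_nhds
    · filter_upwards [self_mem_nhdsWithin] with δ hδ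
      have : (0:ℝ) < δ := hδ
      simpa using this
  have hlim' := hlim.comp hshift
  have hh := ((tendsto_const_nhds (x := (1:ℝ))).sub (hlim'.norm.pow 2)).div
    (((tendsto_const_nhds (x := α)).sub hlim').norm.pow 2)
    (pow_ne_zero 2 (norm_ne_zero_iff.2 (sub_ne_zero.2 hLα.symm)))
  rw [hL, one_pow, sub_self, zero_div] at hh
  have hh2 := ENNReal.tendsto_ofReal hh
  rw [ENNReal.ofReal_zero] at hh2
  set K : ENNReal := ENNReal.ofReal (4 ^ d) * ENNReal.ofReal ((2 * Real.pi) ^ d) with hK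
  have hKt : K ≠ ⊤ := ENNReal.mul_ne_top ENNReal.ofReal_ne_top ENNReal.ofReal_ne_top
  have hh3 := ENNReal.Tendsto.const_mul hh2 (Or.inr hKt)
  rw [mul_zero] at hh3
  have hz0 : Tendsto (fun r => σ (Metric.closedBall z r) /
      torusLebesgue d (Metric.closedBall z r)) (𝓝[>] 0) (𝓝 0) := by
    refine tendsto_of_tendsto_of_tendsto_of_le_of_le' tendsto_const_nhds hh3
      (Eventually.of_forall fun _ => zero_le) ?_
    filter_upwards [Ioo_mem_nhdsGT (show (0:ℝ) < 1 by norm_num)] with δ hδ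
    refine ENNReal.div_le_of_le_mul ?_
    refine (clark_ball d _ α σ hσ z hz4 δ hδ.1 hδ.2).trans ?_
    have hb := torus_ball d z hz4 δ hδ.1 hδ.2
    have hp : ENNReal.ofReal ((2 * Real.pi) ^ d) ≠ 0 := by
      have : 0 < (2 * Real.pi) ^ d := pow_pos Real.two_pi_pos d
      simpa using this
    refine le_trans (le_of_eq ?_) (mul_le_mul_right hb _)
    rw [mul_pow, ENNReal.ofReal_mul (by positivity), hK]
    simp only [Function.comp_def]
    generalize ENNReal.ofReal ((1 - ‖(_ : ℂ)‖ ^ 2) / _) = H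
    calc _ = ENNReal.ofReal (4 ^ d) * ENNReal.ofReal (δ ^ d) * H * 1 := by ring
      _ = _ := by
        rw [← ENNReal.mul_inv_cancel hp ENNReal.ofReal_ne_top]; ring
  exact tendsto_nhds_unique hz1 hz0

/-- Let `φ` be a rational inner function on the polydisk `𝔻^d` and let
`α ∈ 𝕋`. Then the Clark measure `σ_α` is singular with respect to Lebesgue measure
on `𝕋^d`. -/
theorem clark_measure_singular
    (d : ℕ) (hd : 0 < d) (p q : MvPolynomial (Fin d) ℂ)
    (hRIF : IsRIFd d p q) (α : ℂ) (hα : ‖α‖ = 1)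
    (σ : Measure (Fin d → ℂ))
    (hσ : IsClarkMeasureD d (fun z => MvPolynomial.eval z q / MvPolynomial.eval z p) α σ) :
    σ.MutuallySingular (torusLebesgue d) := by
  exact clark_aux d p q hRIF α hα σ hσ
end
end

section
/- Let φ = p̃/p be a bidegree (m,n) rational inner function on 𝔻². For each α ∈ 𝕋 and any choice of base point τ₀ ∈ 𝕋, there exist functions g₁^α,…,g_n^α defined on 𝕋 and analytic on 𝕋∖{τ₀} such that the unimodular level set C_α(φ) is the union of the n graphs {(ζ, g_j^α(ζ)) : ζ ∈ 𝕋}, j = 1,…,n, possibly together with finitely many vertical lines {ζ ∈ 𝕋² : ζ₁ = τ_i}, i = 1,…,k, with τ_i ∈ 𝕋. -/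
open MeasureTheory Complex Filter Topology

noncomputable section

/-- The open unit bidisk `𝔻²` in `ℂ²`. -/
def bidisk : Set (ℂ × ℂ) := {z | ‖z.1‖ < 1 ∧ ‖z.2‖ < 1}

/-- The closed bidisk. -/
def closedBidisk : Set (ℂ × ℂ) := {z | ‖z.1‖ ≤ 1 ∧ ‖z.2‖ ≤ 1}

/-- The distinguished boundary `𝕋²` of the bidisk. -/
def torus2 : Set (ℂ × ℂ) := {z | ‖z.1‖ = 1 ∧ ‖z.2‖ = 1}

/-- Evaluation of a two-variable polynomial at a point of `ℂ²`. -/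
def ev (p : MvPolynomial (Fin 2) ℂ) (z : ℂ × ℂ) : ℂ :=
  MvPolynomial.eval ![z.1, z.2] p

/-- The rational function `φ = p̃/p`. -/
def rif (p pt : MvPolynomial (Fin 2) ℂ) (z : ℂ × ℂ) : ℂ := ev pt z / ev p z

/-- The partial derivative `∂φ/∂z₁` of `φ = p̃/p`, via the quotient rule. -/
def dphi1 (p pt : MvPolynomial (Fin 2) ℂ) (z : ℂ × ℂ) : ℂ :=
  (ev (MvPolynomial.pderiv 0 pt) z * ev p z - ev pt z * ev (MvPolynomial.pderiv 0 p) z) /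
    (ev p z) ^ 2

/-- The partial derivative `∂φ/∂z₂` of `φ = p̃/p`, via the quotient rule. -/
def dphi2 (p pt : MvPolynomial (Fin 2) ℂ) (z : ℂ × ℂ) : ℂ :=
  (ev (MvPolynomial.pderiv 1 pt) z * ev p z - ev pt z * ev (MvPolynomial.pderiv 1 p) z) /
    (ev p z) ^ 2

/-- `pt` is the reflection `p̃(z₁,z₂) = z₁^m z₂^n conj(p(1/conj z₁, 1/conj z₂))` of `p`
at bidegree `(m,n)`. -/
def IsReflection2 (m n : ℕ) (p pt : MvPolynomial (Fin 2) ℂ) : Prop :=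
  ∀ z : ℂ × ℂ, z.1 ≠ 0 → z.2 ≠ 0 →
    ev pt z = z.1 ^ m * z.2 ^ n *
      (starRingEnd ℂ) (ev p (((starRingEnd ℂ) z.1)⁻¹, ((starRingEnd ℂ) z.2)⁻¹))

/-- The data of a bidegree `(m,n)` rational inner function `φ = p̃/p` on the bidisk
(with `m, n ≥ 1`):  `p` has degree `m` in `z₁` and `n` in `z₂`, is zero-free on `𝔻²`,
and has no common factor with its reflection `p̃`. -/
structure IsRIF2 (m n : ℕ) (p pt : MvPolynomial (Fin 2) ℂ) : Prop where
  hm : 1 ≤ m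
  hn : 1 ≤ n
  deg1 : MvPolynomial.degreeOf 0 p = m
  deg2 : MvPolynomial.degreeOf 1 p = n
  stable : ∀ z ∈ bidisk, ev p z ≠ 0
  coprime : ∀ r : MvPolynomial (Fin 2) ℂ, r ∣ p → r ∣ pt → IsUnit r
  reflection : IsReflection2 m n p pt

/-- The unimodular level set `C_α(φ)`, the closure of the set of points of `𝕋²` where
the radial limit of `φ` equals `α`. -/
def levelSet2 (p pt : MvPolynomial (Fin 2) ℂ) (α : ℂ) : Set (ℂ × ℂ) :=
  closure {ζ | ζ ∈ torus2 ∧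
    Tendsto (fun r : ℝ => rif p pt ((r : ℂ) * ζ.1, (r : ℂ) * ζ.2))
      (𝓝[<] (1 : ℝ)) (𝓝 α)}

/-- `α` is an exceptional value for `φ = p̃/p`: some horizontal or vertical line of `𝕋²`
is contained in `C_α(φ)`. -/
def IsExceptional (p pt : MvPolynomial (Fin 2) ℂ) (α : ℂ) : Prop :=
  ∃ τ : ℂ, ‖τ‖ = 1 ∧
    ({ζ : ℂ × ℂ | ζ.1 = τ ∧ ‖ζ.2‖ = 1} ⊆ levelSet2 p pt α ∨
     {ζ : ℂ × ℂ | ‖ζ.1‖ = 1 ∧ ζ.2 = τ} ⊆ levelSet2 p pt α)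

/-- `α` is a generic value for `φ = p̃/p`. -/
def IsGenericValue (p pt : MvPolynomial (Fin 2) ℂ) (α : ℂ) : Prop :=
  ¬ IsExceptional p pt α

/-- Normalized Lebesgue (arclength) measure on the unit circle, as a measure on `ℂ`. -/
def mCircle : Measure ℂ :=
  (ENNReal.ofReal (2 * Real.pi))⁻¹ •
    Measure.map (fun θ : ℝ => Complex.exp ((θ : ℂ) * Complex.I))
      (MeasureTheory.volume.restrict (Set.Ico 0 (2 * Real.pi)))

/-- The two-variable product Poisson kernel. -/
def poisson2 (z ζ : ℂ × ℂ) : ℝ :=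
  ((1 - ‖z.1‖ ^ 2) / ‖ζ.1 - z.1‖ ^ 2) * ((1 - ‖z.2‖ ^ 2) / ‖ζ.2 - z.2‖ ^ 2)

/-- `σ` is the Clark measure of `φ = p̃/p` at parameter `α`: a positive Borel measure
on `𝕋²` whose Poisson integral is `(1-|φ(z)|²)/|α-φ(z)|²`. -/
def IsClarkMeasure2 (p pt : MvPolynomial (Fin 2) ℂ) (α : ℂ) (σ : Measure (ℂ × ℂ)) : Prop :=
  σ torus2ᶜ = 0 ∧
  ∀ z ∈ bidisk,
    ∫⁻ ζ, ENNReal.ofReal (poisson2 z ζ) ∂σ =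
      ENNReal.ofReal ((1 - ‖rif p pt z‖ ^ 2) / ‖α - rif p pt z‖ ^ 2)

/-- `g₁, …, g_n : 𝕋 → 𝕋` are functions on the circle, analytic except possibly at one
base point `τ₀ ∈ 𝕋`. -/
def IsGraphFamily (n : ℕ) (g : Fin n → ℂ → ℂ) : Prop :=
  (∀ j, ∀ ζ : ℂ, ‖ζ‖ = 1 → ‖g j ζ‖ = 1) ∧
  ∃ τ₀ : ℂ, ‖τ₀‖ = 1 ∧ ∀ j, ∀ θ : ℝ,
    Complex.exp ((θ : ℂ) * Complex.I) ≠ τ₀ →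
      AnalyticAt ℝ (fun t : ℝ => g j (Complex.exp ((t : ℂ) * Complex.I))) θ

/-- The union of the graphs `{(ζ, g_j(ζ)) : ζ ∈ 𝕋}`. -/
def graphUnion (n : ℕ) (g : Fin n → ℂ → ℂ) : Set (ℂ × ℂ) :=
  ⋃ j, {w : ℂ × ℂ | ‖w.1‖ = 1 ∧ w.2 = g j w.1}

/-- The vertical line `{ζ ∈ 𝕋² : ζ₁ = τ}`. -/
def vLine (τ : ℂ) : Set (ℂ × ℂ) := {w : ℂ × ℂ | w.1 = τ ∧ ‖w.2‖ = 1}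

section
open Polynomial

open Polynomial in
/-- polynomial attached to a coefficient vector -/
def pv {k : ℕ} (u : Fin k → ℂ) : ℂ[X] := ∑ i : Fin k, C (u i) * X ^ (i : ℕ)

open Polynomial in
theorem pv_coeff {k : ℕ} (u : Fin k → ℂ) (j : ℕ) :
    (pv u).coeff j = if h : j < k then u ⟨j, h⟩ else 0 := by
  unfold pv
  simp only [finsetSum_coeff, coeff_C_mul, coeff_X_pow]
  split_ifs with h
  · rw [Finset.sum_eq_single ⟨j, h⟩]
    · simp
    · intro b _ hb
      have : j ≠ b := fun e => hb (by ext; simp [e])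
      simp [this]
    · simp
  · apply Finset.sum_eq_zero
    intro b _
    have : j ≠ b := by have := b.2; omega
    simp [this]

open Polynomial in
theorem pv_degree_lt {k : ℕ} (u : Fin k → ℂ) : (pv u).degree < k := by
  rw [degree_lt_iff_coeff_zero]
  intro m hm
  rw [pv_coeff, dif_neg (by omega)]

/-- coefficient functional -/
def cf (k : ℕ) (j : ℕ) : (Fin k → ℂ) →L[ℂ] ℂ :=
  if h : j < k then ContinuousLinearMap.proj ⟨j, h⟩ else 0

theorem cf_apply (k j : ℕ) (u : Fin k → ℂ) : cf k j u = (pv u).coeff j := by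
  rw [pv_coeff, cf]; split_ifs <;> rfl

open Polynomial in
theorem hensel (A : ℝ → ℂ[X]) (t0 : ℝ) (f g : ℂ[X]) (hf : f.Monic) (hg : g.Monic)
    (hfg : IsCoprime f g) (h0 : A t0 = f * g)
    (hA : ∀ k, AnalyticAt ℝ (fun t => (A t).coeff k) t0)
    (hm : ∀ᶠ t in 𝓝 t0, (A t).Monic ∧ (A t).natDegree = f.natDegree + g.natDegree) :
    ∃ F G : ℝ → ℂ[X], (∀ k, AnalyticAt ℝ (fun t => (F t).coeff k) t0) ∧
      (∀ k, AnalyticAt ℝ (fun t => (G t).coeff k) t0) ∧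
      (∀ t, (F t).Monic ∧ (F t).natDegree = f.natDegree) ∧
      (∀ t, (G t).Monic ∧ (G t).natDegree = g.natDegree) ∧
      ∀ᶠ t in 𝓝 t0, A t = F t * G t := by
  set k := f.natDegree with hk
  set l := g.natDegree with hl
  have mon : ∀ (q : ℂ[X]) (hq : q.Monic) (u : Fin q.natDegree → ℂ), (q + pv u).Monic ∧
      (q + pv u).natDegree = q.natDegree := by
    intro q hq u
    have : (pv u).degree < q.degree := by
      rw [degree_eq_natDegree hq.ne_zero]; exact pv_degree_lt u
    refine ⟨hq.add_of_left this, ?_⟩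
    exact natDegree_eq_of_degree_eq (degree_add_eq_left_of_degree_lt this)
  let E := (Fin k → ℂ) × (Fin l → ℂ)
  let Φ : E → (Fin (k + l) → ℂ) := fun w j => ((f + pv w.1) * (g + pv w.2)).coeff j
  let a : ℕ → E →L[ℂ] ℂ := fun i => (cf k i).comp (ContinuousLinearMap.fst ℂ _ _)
  let b : ℕ → E →L[ℂ] ℂ := fun i => (cf l i).comp (ContinuousLinearMap.snd ℂ _ _)
  have ha : ∀ i w, a i w = (pv w.1).coeff i := fun i w => cf_apply _ _ _
  have hb : ∀ i w, b i w = (pv w.2).coeff i := fun i w => cf_apply _ _ _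
  have hΦ : ∀ w j, Φ w j = ∑ x ∈ Finset.HasAntidiagonal.antidiagonal (j : ℕ),
      (f.coeff x.1 + a x.1 w) * (g.coeff x.2 + b x.2 w) := by
    intro w j
    simp only [Φ, coeff_mul, coeff_add, ha, hb]
  let L : E →L[ℂ] (Fin (k + l) → ℂ) := ContinuousLinearMap.pi fun j =>
    ∑ x ∈ Finset.HasAntidiagonal.antidiagonal (j : ℕ), (f.coeff x.1 • b x.2 + g.coeff x.2 • a x.1)
  have hL : ∀ w j, L w j = (f * pv w.2 + pv w.1 * g).coeff j := by
    intro w j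
    simp only [L, ContinuousLinearMap.coe_pi', sum_apply,
      add_apply, smul_apply, coeff_add, coeff_mul,
      ← Finset.sum_add_distrib, ha, hb, smul_eq_mul]
    refine Finset.sum_congr rfl fun x _ => ?_
    ring
  have hcd : ContDiffAt ℂ ⊤ Φ 0 := by
    have : Φ = fun w (j : Fin (k + l)) => ∑ x ∈ Finset.HasAntidiagonal.antidiagonal (j : ℕ),
      (f.coeff x.1 + a x.1 w) * (g.coeff x.2 + b x.2 w) := by
      funext w j; exact hΦ w j
    rw [this]
    fun_prop
  have hder : HasFDerivAt Φ L 0 := by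
    rw [hasFDerivAt_pi']
    intro j
    have e1 : (fun w => Φ w j) = fun w => ∑ x ∈ Finset.HasAntidiagonal.antidiagonal (j : ℕ),
      (f.coeff x.1 + a x.1 w) * (g.coeff x.2 + b x.2 w) := by
      funext w; exact hΦ w j
    have e2 : (ContinuousLinearMap.proj j).comp L =
      ∑ x ∈ Finset.HasAntidiagonal.antidiagonal (j : ℕ), (f.coeff x.1 • b x.2 + g.coeff x.2 • a x.1) := by
      ext w <;> simp [L]
    rw [e1, e2]
    apply HasFDerivAt.fun_sum
    intro x _
    have h1 : HasFDerivAt (fun w => f.coeff x.1 + a x.1 w) (a x.1) 0 :=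
      ((a x.1).hasFDerivAt).const_add _
    have h2 : HasFDerivAt (fun w => g.coeff x.2 + b x.2 w) (b x.2) 0 :=
      ((b x.2).hasFDerivAt).const_add _
    have h3 := h1.fun_mul h2
    simp only [map_zero, add_zero] at h3
    exact h3
  have hinj : Function.Injective L := by
    rw [injective_iff_map_eq_zero]
    intro w hw
    have hz : f * pv w.2 + pv w.1 * g = 0 := by
      ext j
      by_cases hj : j < k + l
      · have := congrFun hw ⟨j, hj⟩
        rw [hL] at this
        simpa using this
      · rw [coeff_zero]
        apply coeff_eq_zero_of_degree_lt
        refine lt_of_lt_of_le ?_ (show ((k + l : ℕ) : WithBot ℕ) ≤ j by exact_mod_cast (by omega))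
        refine (degree_add_le _ _).trans_lt (max_lt ?_ ?_)
        · rw [degree_mul, degree_eq_natDegree hf.ne_zero, Nat.cast_add]
          exact WithBot.add_lt_add_left (by simp) (pv_degree_lt _)
        · rw [degree_mul, degree_eq_natDegree hg.ne_zero, Nat.cast_add]
          exact WithBot.add_lt_add_right (by simp) (pv_degree_lt _)
    have hd : f ∣ pv w.1 * g := by
      refine ⟨-pv w.2, ?_⟩
      linear_combination hz
    have hd2 : f ∣ pv w.1 := hfg.dvd_of_dvd_mul_right hd
    have hu : pv w.1 = 0 := by
      refine eq_zero_of_dvd_of_degree_lt hd2 ?_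
      rw [degree_eq_natDegree hf.ne_zero]; exact pv_degree_lt _
    have hv : pv w.2 = 0 := by
      rw [hu, zero_mul, add_zero] at hz
      exact (mul_eq_zero.1 hz).resolve_left hf.ne_zero
    ext i
    · have := pv_coeff w.1 i
      rw [hu] at this
      simpa using this.symm
    · have := pv_coeff w.2 i
      rw [hv] at this
      simpa using this.symm
  let L' : E ≃ₗ[ℂ] (Fin (k + l) → ℂ) :=
    LinearMap.linearEquivOfInjective (L : E →ₗ[ℂ] _) hinj (by simp [E])
  let Le : E ≃L[ℂ] (Fin (k + l) → ℂ) := L'.toContinuousLinearEquiv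
  have hLe : (Le : E →L[ℂ] _) = L := by
    ext w <;> rfl
  have hder' : HasFDerivAt Φ (Le : E →L[ℂ] _) 0 := by rw [hLe]; exact hder
  have hn : (⊤ : WithTop ℕ∞) ≠ 0 := by simp
  let inv := hcd.localInverse hder' hn
  have hinvan : AnalyticAt ℂ inv (Φ 0) := (hcd.to_localInverse hder' hn).analyticAt
  have hright : ∀ᶠ y in 𝓝 (Φ 0), Φ (inv y) = y :=
    (hcd.hasStrictFDerivAt' hder' hn).eventually_right_inverse
  let cA : ℝ → (Fin (k + l) → ℂ) := fun t j => (A t).coeff j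
  have hcA : AnalyticAt ℝ cA t0 := by
    rw [analyticAt_pi_iff]
    intro j; exact hA j
  have hc0 : cA t0 = Φ 0 := by
    funext j
    simp [cA, Φ, h0, pv]
  have hcomp : AnalyticAt ℝ (fun t => inv (cA t)) t0 := by
    have h1 : AnalyticAt ℝ inv (cA t0) := by rw [hc0]; exact hinvan.restrictScalars
    exact h1.comp hcA
  refine ⟨fun t => f + pv (inv (cA t)).1, fun t => g + pv (inv (cA t)).2, ?_, ?_,
    fun t => mon f hf _, fun t => mon g hg _, ?_⟩
  · intro i
    simp only [coeff_add, pv_coeff]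
    refine analyticAt_const.add ?_
    split_ifs with h
    · have h1 : AnalyticAt ℝ (fun t => (inv (cA t)).1) t0 := analyticAt_fst.comp hcomp
      exact (analyticAt_pi_iff.1 h1) ⟨i, h⟩
    · exact analyticAt_const
  · intro i
    simp only [coeff_add, pv_coeff]
    refine analyticAt_const.add ?_
    split_ifs with h
    · have h1 : AnalyticAt ℝ (fun t => (inv (cA t)).2) t0 := analyticAt_snd.comp hcomp
      exact (analyticAt_pi_iff.1 h1) ⟨i, h⟩
    · exact analyticAt_const
  · have hr : ∀ᶠ t in 𝓝 t0, Φ (inv (cA t)) = cA t := by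
      have := hcA.continuousAt.tendsto
      rw [hc0] at this
      exact this.eventually hright
    filter_upwards [hr, hm] with t ht hmt
    obtain ⟨m1, d1⟩ := mon f hf (inv (cA t)).1
    obtain ⟨m2, d2⟩ := mon g hg (inv (cA t)).2
    have m3 := m1.mul m2
    have d3 := m1.natDegree_mul m2
    ext j
    rcases lt_trichotomy j (k + l) with hj | hj | hj
    · exact (congrFun ht ⟨j, hj⟩).symm
    · have e1 := hmt.1.coeff_natDegree
      have e2 := m3.coeff_natDegree
      rw [hmt.2] at e1
      rw [d3, d1, d2] at e2
      rw [hj]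
      exact e1.trans e2.symm
    · rw [coeff_eq_zero_of_natDegree_lt (by rw [hmt.2]; exact hj),
        coeff_eq_zero_of_natDegree_lt (by rw [d3, d1, d2]; exact hj)]

theorem esymm_sq (s : Multiset ℂ) : s.sum ^ 2 = (s.map (fun a => a ^ 2)).sum + 2 * s.esymm 2 := by
  induction s using Multiset.induction with
  | empty => simp [Multiset.esymm, Multiset.powersetCard_zero_right]
  | cons a s ih =>
    have : (a ::ₘ s).esymm 2 = s.esymm 2 + a * s.sum := by
      simp [Multiset.esymm, Multiset.powersetCard_cons, Multiset.powersetCard_one,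
        Multiset.map_map]
      simpa using Multiset.sum_map_mul_left (s := s) (f := fun x => x) (a := a)
    rw [this, Multiset.sum_cons, Multiset.map_cons, Multiset.sum_cons]
    linear_combination ih

theorem sumroots (p : ℂ[X]) (hp : p.Monic) (N : ℕ) (hn : p.natDegree = N + 1) :
    p.roots.sum = - p.coeff N := by
  have hs := IsAlgClosed.splits p
  have hc : p.roots.card = p.natDegree := hs.natDegree_eq_card_roots.symm
  have h1 := coeff_eq_esymm_roots_of_card hc (k := N) (by omega)
  have e1 : p.natDegree - N = 1 := by omega
  rw [e1, hp.leadingCoeff] at h1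
  rw [h1]
  simp [Multiset.esymm, Multiset.powersetCard_one, Multiset.map_map]

theorem sumsq (p : ℂ[X]) (hp : p.Monic) (N : ℕ) (hn : p.natDegree = N + 2) :
    (p.roots.map (fun a => a ^ 2)).sum = (p.coeff (N + 1)) ^ 2 - 2 * p.coeff N := by
  have hs := IsAlgClosed.splits p
  have hc : p.roots.card = p.natDegree := hs.natDegree_eq_card_roots.symm
  have h1 := coeff_eq_esymm_roots_of_card hc (k := N) (by omega)
  have e1 : p.natDegree - N = 2 := by omega
  rw [e1, hp.leadingCoeff] at h1
  have h2 := sumroots p hp (N + 1) hn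
  have h3 := esymm_sq p.roots
  rw [h1]
  rw [h2] at h3
  linear_combination -h3

theorem im_sum (s : Multiset ℂ) (hs : ∀ z ∈ s, z.im = 0) : s.sum.im = 0 := by
  induction s using Multiset.induction with
  | empty => simp
  | cons a s ih =>
    rw [Multiset.sum_cons, add_im, hs a (by simp), ih (fun z hz => hs z (by simp [hz])), add_zero]

theorem sq_le_sum (s : Multiset ℂ) (hs : ∀ z ∈ s, z.im = 0) :
    (s.map (fun a => a ^ 2)).sum.im = 0 ∧ 0 ≤ (s.map (fun a => a ^ 2)).sum.re ∧
    ∀ z ∈ s, ‖z‖ ^ 2 ≤ (s.map (fun a => a ^ 2)).sum.re := by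
  induction s using Multiset.induction with
  | empty => simp
  | cons a s ih =>
    obtain ⟨h1, h2, h3⟩ := ih (fun z hz => hs z (by simp [hz]))
    have ha := hs a (by simp)
    have hn : ‖a‖ ^ 2 = (a ^ 2).re := by
      rw [← normSq_eq_norm_sq, normSq_apply, pow_two, mul_re]; rw [ha]; ring
    have hi : (a ^ 2).im = 0 := by rw [pow_two, mul_im, ha]; ring
    simp only [Multiset.map_cons, Multiset.sum_cons, add_im, add_re, Multiset.mem_cons]
    have h4 : 0 ≤ ‖a‖ ^ 2 := by positivity
    refine ⟨by rw [hi, h1, add_zero], by linarith, ?_⟩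
    rintro z (rfl | hz)
    · linarith
    · have := h3 z hz; linarith

theorem im_pow_le (p : ℂ[X]) (hp : p.Monic) (hr : ∀ z, p.IsRoot z → z.im = 0) (z : ℂ) :
    |z.im| ^ p.natDegree ≤ ‖p.eval z‖ := by
  have hs := IsAlgClosed.splits p
  have hc : p.roots.card = p.natDegree := hs.natDegree_eq_card_roots.symm
  have h2 : p.eval z = (p.roots.map (fun a => z - a)).prod := by
    conv_lhs => rw [hs.eq_prod_roots_of_monic hp]
    rw [eval_multiset_prod, Multiset.map_map]
    simp
  have h3 : ∀ a ∈ p.roots, a.im = 0 := fun a ha => hr a (isRoot_of_mem_roots ha)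
  rw [h2, ← hc]
  generalize p.roots = s at h3
  induction s using Multiset.induction with
  | empty => simp
  | cons a s ih =>
    rw [Multiset.card_cons, Multiset.map_cons, Multiset.prod_cons, norm_mul, pow_succ, mul_comm]
    have h5 := ih (fun a ha => h3 a (by simp [ha]))
    have h6 : |z.im| ≤ ‖z - a‖ := by
      have := abs_im_le_norm (z - a)
      rwa [sub_im, h3 a (by simp), sub_zero] at this
    gcongr

theorem eval_an {A : ℝ → ℂ[X]} {t0 : ℝ} (n : ℕ) {a : ℝ → ℂ}
    (hA : ∀ k, AnalyticAt ℝ (fun t => (A t).coeff k) t0)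
    (hd : ∀ᶠ t in 𝓝 t0, (A t).natDegree < n) (ha : AnalyticAt ℝ a t0) :
    AnalyticAt ℝ (fun t => (A t).eval (a t)) t0 := by
  have h1 : AnalyticAt ℝ (fun t => ∑ i ∈ Finset.range n, (A t).coeff i * a t ^ i) t0 := by
    apply Finset.analyticAt_fun_sum
    intro i _
    exact (hA i).mul (ha.pow i)
  refine h1.congr ?_
  filter_upwards [hd] with t ht
  rw [eval_eq_sum_range' ht]

theorem real_limit {A : ℝ → ℂ[X]} {t0 : ℝ} (n : ℕ)
    (hA : ∀ k, AnalyticAt ℝ (fun t => (A t).coeff k) t0)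
    (hd : ∀ t, (A t).Monic ∧ (A t).natDegree = n)
    (hr : ∀ᶠ t in 𝓝[≠] t0, ∀ z, (A t).IsRoot z → z.im = 0) :
    ∀ᶠ t in 𝓝 t0, ∀ z, (A t).IsRoot z → z.im = 0 := by
  rw [eventually_nhdsWithin_iff] at hr
  have key : ∀ z, (A t0).IsRoot z → z.im = 0 := by
    intro z hz
    have h1 : AnalyticAt ℝ (fun t => (A t).eval z) t0 :=
      eval_an (n + 1) hA (Eventually.of_forall fun t => by rw [(hd t).2]; omega) analyticAt_const
    have h2 : Tendsto (fun t => ‖(A t).eval z‖) (𝓝[≠] t0) (𝓝 ‖(A t0).eval z‖) :=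
      (h1.continuousAt.norm.tendsto).mono_left nhdsWithin_le_nhds
    have h3 : |z.im| ^ n ≤ ‖(A t0).eval z‖ := by
      refine ge_of_tendsto h2 ?_
      rw [← eventually_nhdsWithin_iff] at hr
      filter_upwards [hr] with t ht
      rw [← (hd t).2]
      exact im_pow_le _ (hd t).1 ht z
    rw [hz.eq_zero, norm_zero] at h3
    have h4 : |z.im| ^ n = 0 := le_antisymm h3 (by positivity)
    simpa using eq_zero_of_pow_eq_zero h4
  filter_upwards [hr] with t ht
  by_cases h : t = t0
  · rw [h]; exact key
  · exact ht h

theorem an_div {f : ℝ → ℂ} {t0 : ℝ} (hf : AnalyticAt ℝ f t0) (N : ℕ) (K : ℝ)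
    (hb : ∀ᶠ t in 𝓝 t0, ‖f t‖ ≤ K * |t - t0| ^ N) :
    ∃ g : ℝ → ℂ, AnalyticAt ℝ g t0 ∧ ∀ᶠ t in 𝓝 t0, f t = (t - t0) ^ N • g t := by
  rw [← natCast_le_analyticOrderAt hf]
  by_contra hcon
  push Not at hcon
  obtain ⟨k, hk⟩ := ENat.ne_top_iff_exists.1 (ne_top_of_lt hcon)
  rw [← hk] at hcon
  have hkN : k < N := by exact_mod_cast hcon
  obtain ⟨g, hg, hg0, hfg⟩ := (hf.analyticOrderAt_eq_natCast).1 hk.symm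
  have h1 : ∀ᶠ t in 𝓝[≠] t0, ‖g t‖ ≤ K * |t - t0| ^ (N - k) := by
    filter_upwards [eventually_nhdsWithin_of_eventually_nhds hfg,
      eventually_nhdsWithin_of_eventually_nhds hb, self_mem_nhdsWithin] with t h1 h2 h3
    have h4 : 0 < |t - t0| := abs_pos.2 (sub_ne_zero.2 h3)
    rw [h1, norm_smul, norm_pow, Real.norm_eq_abs] at h2
    have h5 : |t - t0| ^ N = |t - t0| ^ k * |t - t0| ^ (N - k) := by
      rw [← pow_add]; congr 1; omega
    rw [h5] at h2
    have h6 : 0 < |t - t0| ^ k := by positivity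
    refine le_of_mul_le_mul_left ?_ h6
    linarith
  have h2 : Tendsto (fun t => ‖g t‖) (𝓝[≠] t0) (𝓝 ‖g t0‖) :=
      (hg.continuousAt.norm.tendsto).mono_left nhdsWithin_le_nhds
  have h3 : Tendsto (fun t => K * |t - t0| ^ (N - k)) (𝓝[≠] t0) (𝓝 0) := by
    have : ContinuousAt (fun t : ℝ => K * |t - t0| ^ (N - k)) t0 := by fun_prop
    have h := this.tendsto.mono_left (nhdsWithin_le_nhds (s := {t0}ᶜ))
    simpa [zero_pow (show N - k ≠ 0 by omega)] using h
  have := le_of_tendsto_of_tendsto h2 h3 h1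
  exact hg0 (by simpa using this)

/-- local analytic splitting -/
def LocSplit (A : ℝ → ℂ[X]) (t0 : ℝ) : Prop :=
  ∃ M : Multiset (ℝ → ℂ), (∀ f ∈ M, AnalyticAt ℝ f t0) ∧
    ∀ᶠ t in 𝓝 t0, A t = (M.map fun f => X - C (f t)).prod

/-- hypotheses for Rellich -/
def RelHyp (n : ℕ) (A : ℝ → ℂ[X]) (t0 : ℝ) : Prop :=
  (∀ k, AnalyticAt ℝ (fun t => (A t).coeff k) t0) ∧
  ∀ᶠ t in 𝓝 t0, (A t).Monic ∧ (A t).natDegree = n ∧ ∀ z, (A t).IsRoot z → z.im = 0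

theorem rel_split (n : ℕ) (ih : ∀ k < n, ∀ A t0, RelHyp k A t0 → LocSplit A t0)
    (A : ℝ → ℂ[X]) (t0 : ℝ) (hA : RelHyp n A t0) (r s : ℂ) (hrs : r ≠ s)
    (hr : (A t0).IsRoot r) (hs : (A t0).IsRoot s) : LocSplit A t0 := by
  obtain ⟨hm0, hd0, -⟩ := hA.2.self_of_nhds
  have h0 := hm0.ne_zero
  obtain ⟨g, hg, hgd⟩ := exists_eq_pow_rootMultiplicity_mul_and_not_dvd (A t0) h0 r
  set k := rootMultiplicity r (A t0) with hk
  have hkpos : 0 < k := (rootMultiplicity_pos h0).2 hr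
  have hfm : ((X - C r) ^ k).Monic := (monic_X_sub_C r).pow k
  have hgm : g.Monic := by
    rw [hg] at hm0
    exact hfm.of_mul_monic_left hm0
  have hfd : ((X - C r) ^ k).natDegree = k := by
    rw [(monic_X_sub_C r).natDegree_pow, natDegree_X_sub_C, mul_one]
  have hcop : IsCoprime ((X - C r) ^ k) g :=
    (((irreducible_X_sub_C r).coprime_iff_not_dvd).2 hgd).pow_left
  have hgs : g.IsRoot s := by
    have : (A t0).eval s = 0 := hs
    rw [hg, eval_mul] at this
    refine (mul_eq_zero.1 this).resolve_left ?_
    rw [eval_pow, eval_sub, eval_X, eval_C]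
    exact pow_ne_zero _ (sub_ne_zero.2 hrs.symm)
  have hgd' : 0 < g.natDegree := by
    rw [Nat.pos_iff_ne_zero]
    intro h
    rw [eq_one_of_monic_natDegree_zero hgm h] at hgs
    simp [IsRoot] at hgs
  have hsum : n = k + g.natDegree := by
    rw [← hd0, hg, hfm.natDegree_mul hgm, hfd]
  obtain ⟨F, G, hF, hG, hFm, hGm, hFG⟩ := hensel A t0 _ g hfm hgm hcop hg hA.1 (by
    filter_upwards [hA.2] with t ht
    exact ⟨ht.1, by rw [ht.2.1, hfd, hsum]⟩)
  obtain ⟨M1, hM1, h1⟩ := ih k (by omega) F t0 ⟨hF, by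
    filter_upwards [hA.2, hFG] with t ht h
    refine ⟨(hFm t).1, by rw [(hFm t).2, hfd], fun z hz => ht.2.2 z ?_⟩
    rw [h, IsRoot, eval_mul, hz.eq_zero, zero_mul]⟩
  obtain ⟨M2, hM2, h2⟩ := ih g.natDegree (by omega) G t0 ⟨hG, by
    filter_upwards [hA.2, hFG] with t ht h
    refine ⟨(hGm t).1, (hGm t).2, fun z hz => ht.2.2 z ?_⟩
    rw [h, IsRoot, eval_mul, hz.eq_zero, mul_zero]⟩
  refine ⟨M1 + M2, ?_, ?_⟩
  · intro f hf
    rcases Multiset.mem_add.1 hf with h | h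
    exacts [hM1 f h, hM2 f h]
  · filter_upwards [hFG, h1, h2] with t a b c
    rw [a, b, c, Multiset.map_add, Multiset.prod_add]

theorem even_order {q u : ℝ → ℂ} {t0 : ℝ} (hu : ContinuousAt u t0) (hu0 : u t0 ≠ 0) (s : ℕ)
    (hq : ∀ᶠ t in 𝓝 t0, q t = (t - t0) ^ s • u t)
    (hpos : ∀ᶠ t in 𝓝 t0, (q t).im = 0 ∧ 0 ≤ (q t).re) : Even s := by
  by_contra hs
  rw [Nat.not_even_iff_odd] at hs
  have hre : ContinuousAt (fun t => (u t).re) t0 := continuous_re.continuousAt.comp hu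
  have him : ContinuousAt (fun t => (u t).im) t0 := continuous_im.continuousAt.comp hu
  have him0 : (u t0).im = 0 := by
    have h1 : ∀ᶠ t in 𝓝[≠] t0, (u t).im = 0 := by
      filter_upwards [eventually_nhdsWithin_of_eventually_nhds hq,
        eventually_nhdsWithin_of_eventually_nhds hpos, self_mem_nhdsWithin] with t h1 h2 h3
      have h4 := h2.1
      rw [h1, smul_im, smul_eq_mul] at h4
      exact (mul_eq_zero.1 h4).resolve_left (pow_ne_zero _ (sub_ne_zero.2 h3))
    have h2 := him.tendsto.mono_left (nhdsWithin_le_nhds (s := {t0}ᶜ))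
    exact tendsto_nhds_unique (h2.congr' h1) tendsto_const_nhds
  have hge : 0 ≤ (u t0).re := by
    have h2 := hre.tendsto.mono_left (nhdsWithin_le_nhds (s := Set.Ioi t0))
    refine ge_of_tendsto h2 ?_
    filter_upwards [eventually_nhdsWithin_of_eventually_nhds hq,
        eventually_nhdsWithin_of_eventually_nhds hpos, self_mem_nhdsWithin] with t h1 h2 h3
    have h4 := h2.2
    rw [h1, smul_re, smul_eq_mul] at h4
    have h5 : 0 < (t - t0) ^ s := pow_pos (sub_pos.2 h3) s
    exact nonneg_of_mul_nonneg_right h4 h5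
  have hle : (u t0).re ≤ 0 := by
    have h2 := hre.tendsto.mono_left (nhdsWithin_le_nhds (s := Set.Iio t0))
    refine le_of_tendsto h2 ?_
    filter_upwards [eventually_nhdsWithin_of_eventually_nhds hq,
        eventually_nhdsWithin_of_eventually_nhds hpos, self_mem_nhdsWithin] with t h1 h2 h3
    have h4 := h2.2
    rw [h1, smul_re, smul_eq_mul] at h4
    have h5 : (t - t0) ^ s < 0 := hs.pow_neg (sub_neg.2 h3)
    by_contra hcon
    push Not at hcon
    have := mul_neg_of_neg_of_pos h5 hcon
    linarith
  exact hu0 (Complex.ext (le_antisymm hle hge) him0)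

theorem scale_prod (s : ℂ) (M : Multiset ℂ) :
    scaleRoots ((M.map fun f => X - C f).prod) s = (M.map fun f => X - C (s * f)).prod := by
  induction M using Multiset.induction with
  | empty => simp
  | cons a M ih =>
    simp only [Multiset.map_cons, Multiset.prod_cons]
    rw [mul_scaleRoots_of_noZeroDivisors, ih]
    congr 1
    ext i
    rw [coeff_scaleRoots, natDegree_X_sub_C]
    rcases i with _ | _ | i
    · simp [mul_comm]
    · simp [coeff_C, coeff_X]
    · simp [coeff_C, coeff_X]

theorem taylor_prod (s : ℂ) (M : Multiset ℂ) :
    taylor s ((M.map fun f => X - C f).prod) = (M.map fun f => X - C (f - s)).prod := by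
  induction M using Multiset.induction with
  | empty => simp
  | cons a M ih =>
    simp only [Multiset.map_cons, Multiset.prod_cons]
    rw [taylor_mul, ih]
    congr 1
    simp
    ring

theorem eq_of_punct {f g : ℝ → ℂ} {t0 : ℝ} (hf : ContinuousAt f t0) (hg : ContinuousAt g t0)
    (h : ∀ᶠ t in 𝓝[≠] t0, f t = g t) : f t0 = g t0 := by
  have h1 := hf.tendsto.mono_left (nhdsWithin_le_nhds (s := {t0}ᶜ))
  have h2 := hg.tendsto.mono_left (nhdsWithin_le_nhds (s := {t0}ᶜ))
  exact tendsto_nhds_unique (h1.congr' h) h2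

theorem rel_centered (N : ℕ) (ih : ∀ k < N + 2, ∀ A t0, RelHyp k A t0 → LocSplit A t0)
    (B : ℝ → ℂ[X]) (t0 : ℝ) (hB : RelHyp (N + 2) B t0)
    (hc : ∀ᶠ t in 𝓝 t0, (B t).coeff (N + 1) = 0) : LocSplit B t0 := by
  obtain ⟨hBa, hBe⟩ := hB
  set q : ℝ → ℂ := fun t => -2 * (B t).coeff N with hq
  have hqa : AnalyticAt ℝ q t0 := analyticAt_const.mul (hBa N)
  have hroots : ∀ᶠ t in 𝓝 t0, (q t).im = 0 ∧ 0 ≤ (q t).re ∧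
      ∀ z ∈ (B t).roots, ‖z‖ ^ 2 ≤ (q t).re := by
    filter_upwards [hBe, hc] with t ht hct
    have h1 := sumsq (B t) ht.1 N ht.2.1
    have h2 := sq_le_sum (B t).roots (fun z hz => ht.2.2 z (isRoot_of_mem_roots hz))
    rw [h1, hct] at h2
    have e : (0 : ℂ) ^ 2 - 2 * (B t).coeff N = q t := by simp [hq]
    rwa [e] at h2
  by_cases hz : ∀ᶠ t in 𝓝 t0, q t = 0
  · refine ⟨Multiset.replicate (N + 2) (fun _ => 0), ?_, ?_⟩
    · intro f hf
      rw [Multiset.eq_of_mem_replicate hf]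
      exact analyticAt_const
    · filter_upwards [hBe, hroots, hz] with t ht h1 h2
      have hs := IsAlgClosed.splits (B t)
      have hcard : (B t).roots.card = N + 2 := by rw [← ht.2.1, hs.natDegree_eq_card_roots]
      have hr : (B t).roots = Multiset.replicate (N + 2) 0 := by
        rw [Multiset.eq_replicate]
        refine ⟨hcard, fun z hz => ?_⟩
        have := h1.2.2 z hz
        rw [h2, zero_re] at this
        have h3 : ‖z‖ ^ 2 = 0 := le_antisymm this (by positivity)
        simpa using h3
      rw [hs.eq_prod_roots_of_monic ht.1, hr]
      simp
  obtain ⟨s, u, hua, hu0, hqu⟩ := hqa.exists_eventuallyEq_pow_smul_nonzero_iff.2 hz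
  obtain ⟨r, hr⟩ := even_order hua.continuousAt hu0 s hqu
    (hroots.mono fun t ht => ⟨ht.1, ht.2.1⟩)
  set K : ℝ := ‖u t0‖ + 1 with hK
  have hK1 : 1 ≤ K := by rw [hK]; linarith [norm_nonneg (u t0)]
  have huK : ∀ᶠ t in 𝓝 t0, ‖u t‖ ≤ K := by
    have := hua.continuousAt.norm.eventually_lt continuousAt_const (show ‖u t0‖ < K by rw [hK]; linarith)
    exact this.mono fun t ht => ht.le
  have hbd : ∀ᶠ t in 𝓝 t0, ∀ z ∈ (B t).roots, ‖z‖ ≤ K * |t - t0| ^ r := by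
    filter_upwards [hroots, hqu, huK] with t h1 h2 h3 z hz
    have h4 := h1.2.2 z hz
    have h5 : (q t).re ≤ ‖q t‖ := re_le_norm _
    have h6 : ‖q t‖ = (|t - t0| ^ r) ^ 2 * ‖u t‖ := by
      rw [h2, norm_smul, norm_pow, Real.norm_eq_abs, hr, ← pow_mul, mul_two]
    have h7 : 0 ≤ |t - t0| ^ r := by positivity
    refine abs_le_of_sq_le_sq' ?_ (by positivity) |>.2
    rw [mul_pow]
    have h8 : (|t - t0| ^ r) ^ 2 * ‖u t‖ ≤ (|t - t0| ^ r) ^ 2 * K ^ 2 := by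
      gcongr
      nlinarith
    linarith
  have hdiv : ∀ k : ℕ, ∃ c : ℝ → ℂ, AnalyticAt ℝ c t0 ∧
      ∀ᶠ t in 𝓝 t0, (B t).coeff k = (t - t0) ^ (r * (N + 2 - k)) • c t := by
    intro k
    refine an_div (hBa k) _ (K ^ (N + 2 - k) * ((N + 2).choose k)) ?_
    filter_upwards [hbd, hBe] with t h1 h2
    have h3 := coeff_le_of_roots_le (f := RingHom.id ℂ) (B := K * |t - t0| ^ r) k h2.1
      (by simpa using IsAlgClosed.splits (B t)) (by simpa using h1)
    rw [Polynomial.map_id, h2.2.1] at h3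
    refine h3.trans (le_of_eq ?_)
    rw [mul_pow, ← pow_mul]
    ring
  choose c hca hce using hdiv
  let D : ℝ → ℂ[X] := fun t => X ^ (N + 2) + pv (fun k : Fin (N + 2) => c k t)
  have hDm : ∀ t, (D t).Monic ∧ (D t).natDegree = N + 2 := by
    intro t
    have : (pv (fun k : Fin (N + 2) => c k t)).degree < (X ^ (N + 2) : ℂ[X]).degree := by
      rw [degree_X_pow]; exact pv_degree_lt _
    refine ⟨(monic_X_pow _).add_of_left this, ?_⟩
    rw [natDegree_eq_of_degree_eq (degree_add_eq_left_of_degree_lt this), natDegree_X_pow]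
  have hDc : ∀ t k, k < N + 2 → (D t).coeff k = c k t := by
    intro t k hk
    simp only [D, coeff_add, coeff_X_pow, pv_coeff]
    rw [if_neg (by omega), dif_pos hk, zero_add]
  have hDa : ∀ k, AnalyticAt ℝ (fun t => (D t).coeff k) t0 := by
    intro k
    by_cases hk : k < N + 2
    · simp only [hDc _ k hk]; exact hca k
    · simp only [D, coeff_add, pv_coeff, dif_neg hk]
      exact analyticAt_const
  have hscale : ∀ᶠ t in 𝓝 t0, B t = scaleRoots (D t) (((t - t0) ^ r : ℝ) : ℂ) := by
    have hall : ∀ᶠ t in 𝓝 t0, ∀ k : Fin (N + 2),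
        (B t).coeff k = (t - t0) ^ (r * (N + 2 - k)) • c k t :=
      eventually_all.2 fun k => hce k
    filter_upwards [hall, hBe] with t h1 h2
    ext k
    rw [coeff_scaleRoots, (hDm t).2]
    rcases lt_trichotomy k (N + 2) with hk | hk | hk
    · rw [h1 ⟨k, hk⟩, hDc t k hk]
      simp only [real_smul]
      push_cast
      rw [← pow_mul, mul_comm]
    · have e1 := h2.1.coeff_natDegree
      have e2 := (hDm t).1.coeff_natDegree
      rw [h2.2.1] at e1
      rw [(hDm t).2] at e2
      rw [hk, e1, e2]; simp
    · rw [coeff_eq_zero_of_natDegree_lt (by rw [h2.2.1]; exact hk),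
        coeff_eq_zero_of_natDegree_lt (by rw [(hDm t).2]; exact hk), zero_mul]
  have hDr : ∀ᶠ t in 𝓝 t0, ∀ z, (D t).IsRoot z → z.im = 0 := by
    refine real_limit (N + 2) hDa hDm ?_
    filter_upwards [eventually_nhdsWithin_of_eventually_nhds hscale,
        eventually_nhdsWithin_of_eventually_nhds hBe, self_mem_nhdsWithin] with t h1 h2 h3 z hz
    have h4 : (B t).IsRoot ((((t - t0) ^ r : ℝ) : ℂ) * z) := by
      have := scaleRoots_eval₂_mul (p := D t) (RingHom.id ℂ) z (((t - t0) ^ r : ℝ) : ℂ)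
      rw [← h1] at this
      simp only [eval₂_id, RingHom.id_apply] at this
      rw [IsRoot, this, hz.eq_zero, mul_zero]
    have h5 := h2.2.2 _ h4
    rw [im_ofReal_mul] at h5
    exact (mul_eq_zero.1 h5).resolve_left (pow_ne_zero _ (sub_ne_zero.2 h3))
  have hD : RelHyp (N + 2) D t0 := ⟨hDa, hDr.mono fun t ht => ⟨(hDm t).1, (hDm t).2, ht⟩⟩
  have hc1 : (D t0).coeff (N + 1) = 0 := by
    refine eq_of_punct (f := fun t => (D t).coeff (N + 1)) (g := fun _ => 0)
      (hDa _).continuousAt continuousAt_const ?_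
    filter_upwards [eventually_nhdsWithin_of_eventually_nhds hc,
        eventually_nhdsWithin_of_eventually_nhds (hce (N + 1)), self_mem_nhdsWithin] with t h1 h2 h3
    rw [hDc t _ (by omega)]
    rw [h1] at h2
    exact (smul_eq_zero.1 h2.symm).resolve_left (pow_ne_zero _ (sub_ne_zero.2 h3))
  have hc2 : -2 * (D t0).coeff N = u t0 := by
    refine eq_of_punct (f := fun t => -2 * (D t).coeff N) (g := u)
      (analyticAt_const.mul (hDa N)).continuousAt hua.continuousAt ?_
    filter_upwards [eventually_nhdsWithin_of_eventually_nhds hqu,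
        eventually_nhdsWithin_of_eventually_nhds (hce N), self_mem_nhdsWithin] with t h1 h2 h3
    rw [hDc t _ (by omega)]
    have e : N + 2 - N = 2 := by omega
    simp only [hq] at h1
    rw [h2, e, mul_two, ← hr] at h1
    have h4 : (t - t0) ^ s ≠ 0 := pow_ne_zero _ (sub_ne_zero.2 h3)
    rw [mul_smul_comm] at h1
    exact smul_right_injective ℂ h4 h1
  have hsum := sumroots (D t0) (hDm t0).1 (N + 1) (hDm t0).2
  have hsq := sumsq (D t0) (hDm t0).1 N (hDm t0).2
  have hcard : (D t0).roots.card = N + 2 := by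
    rw [← (hDm t0).2, (IsAlgClosed.splits (D t0)).natDegree_eq_card_roots]
  have htwo : ∃ a ∈ (D t0).roots, ∃ b ∈ (D t0).roots, a ≠ b := by
    by_contra hcon
    push Not at hcon
    obtain ⟨a, ha⟩ := Multiset.card_pos_iff_exists_mem.1 (show 0 < (D t0).roots.card by omega)
    have hrep : (D t0).roots = Multiset.replicate (N + 2) a :=
      Multiset.eq_replicate.2 ⟨hcard, fun b hb => (hcon a ha b hb).symm⟩
    rw [hrep] at hsum hsq
    rw [hc1] at hsum hsq
    simp only [Multiset.sum_replicate, neg_zero, nsmul_eq_mul, mul_eq_zero] at hsum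
    have ha0 : a = 0 := hsum.resolve_left (Nat.cast_ne_zero.2 (by omega))
    rw [ha0] at hsq
    simp at hsq
    apply hu0
    rw [← hc2, hsq, mul_zero]
  obtain ⟨a, ha, b, hb, hab⟩ := htwo
  obtain ⟨M, hM, hMe⟩ := rel_split (N + 2) ih D t0 hD a b hab (isRoot_of_mem_roots ha)
    (isRoot_of_mem_roots hb)
  refine ⟨M.map (fun f t => (((t - t0) ^ r : ℝ) : ℂ) * f t), ?_, ?_⟩
  · intro f hf
    obtain ⟨g, hg, rfl⟩ := Multiset.mem_map.1 hf
    refine AnalyticAt.mul ?_ (hM g hg)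
    have h1 : AnalyticAt ℝ (fun t : ℝ => (t - t0) ^ r) t0 := by fun_prop
    exact (ofRealCLM.analyticAt _).comp h1
  · filter_upwards [hscale, hMe] with t h1 h2
    have := scale_prod (((t - t0) ^ r : ℝ) : ℂ) (M.map fun f => f t)
    simp only [Multiset.map_map, Function.comp_def] at this ⊢
    rw [h1, h2, this]

theorem rellich (n : ℕ) : ∀ A t0, RelHyp n A t0 → LocSplit A t0 := by
  induction n using Nat.strong_induction_on with
  | _ n ih =>
  intro A t0 hA
  rcases n with _ | _ | N
  · refine ⟨0, by simp, ?_⟩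
    filter_upwards [hA.2] with t ht
    simpa using eq_one_of_monic_natDegree_zero ht.1 ht.2.1
  · refine ⟨{fun t => -(A t).coeff 0}, ?_, ?_⟩
    · intro f hf
      rw [Multiset.mem_singleton.1 hf]
      exact (hA.1 0).neg
    · filter_upwards [hA.2] with t ht
      rw [Multiset.map_singleton, Multiset.prod_singleton]
      have := ht.1.as_sum
      rw [ht.2.1] at this
      rw [this]
      simp
  · set m : ℝ → ℂ := fun t => -(A t).coeff (N + 1) / ((N + 2 : ℕ) : ℂ) with hm
    have hN : ((N + 2 : ℕ) : ℂ) ≠ 0 := Nat.cast_ne_zero.2 (by omega)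
    have hma : AnalyticAt ℝ m t0 := (hA.1 (N + 1)).neg.div_const
    have hmr : ∀ᶠ t in 𝓝 t0, (m t).im = 0 := by
      filter_upwards [hA.2] with t ht
      have h1 := sumroots (A t) ht.1 (N + 1) ht.2.1
      have h2 := im_sum (A t).roots (fun z hz => ht.2.2 z (isRoot_of_mem_roots hz))
      rw [h1] at h2
      simp only [hm]
      rw [div_natCast_im, h2, zero_div]
    set B : ℝ → ℂ[X] := fun t => taylor (m t) (A t) with hBdef
    have hB : RelHyp (N + 2) B t0 := by
      constructor
      · intro k
        simp only [hBdef, taylor_coeff]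
        refine eval_an (N + 3) ?_ ?_ hma
        · intro j
          simp only [hasseDeriv_coeff]
          exact analyticAt_const.mul (hA.1 _)
        · filter_upwards [hA.2] with t ht
          have := natDegree_hasseDeriv_le (A t) k
          rw [ht.2.1] at this
          omega
      · filter_upwards [hA.2, hmr] with t ht hmt
        refine ⟨?_, ?_, ?_⟩
        · rw [hBdef]; rw [Monic, leadingCoeff_taylor]; exact ht.1
        · simp only [hBdef]; rw [natDegree_taylor, ht.2.1]
        · intro z hz
          have h1 : (A t).IsRoot (z + m t) := by
            rw [IsRoot, ← taylor_eval]; exact hz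
          have := ht.2.2 _ h1
          rwa [add_im, hmt, add_zero] at this
    have hc : ∀ᶠ t in 𝓝 t0, (B t).coeff (N + 1) = 0 := by
      filter_upwards [hA.2] with t ht
      simp only [hBdef, taylor_coeff]
      have hd : (hasseDeriv (N + 1) (A t)).natDegree < 2 := by
        have := natDegree_hasseDeriv_le (A t) (N + 1)
        rw [ht.2.1] at this
        omega
      rw [eval_eq_sum_range' hd, Finset.sum_range_succ, Finset.sum_range_one]
      simp only [hasseDeriv_coeff]
      have e := ht.1.coeff_natDegree
      rw [ht.2.1] at e
      have e2 : 1 + (N + 1) = N + 2 := by omega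
      rw [e2, e]
      simp only [hm, zero_add, Nat.choose_self]
      rw [Nat.choose_symm_of_eq_add (show N + 2 = (N + 1) + 1 by omega), Nat.choose_one_right]
      field_simp
      simp
    obtain ⟨M, hM, hMe⟩ := rel_centered N ih B t0 hB hc
    refine ⟨M.map (fun f t => f t + m t), ?_, ?_⟩
    · intro f hf
      obtain ⟨g, hg, rfl⟩ := Multiset.mem_map.1 hf
      exact (hM g hg).add hma
    · filter_upwards [hMe] with t ht
      have h1 := taylor_prod (-(m t)) (M.map fun f => f t)
      simp only [Multiset.map_map, Function.comp_def, sub_neg_eq_add] at h1 ⊢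
      rw [← h1, ← ht]
      simp [hBdef, taylor_taylor]

/-- circle hypotheses -/
def CirHyp (n : ℕ) (A : ℝ → ℂ[X]) (t0 : ℝ) : Prop :=
  (∀ k, AnalyticAt ℝ (fun t => (A t).coeff k) t0) ∧
  ∀ᶠ t in 𝓝 t0, (A t).Monic ∧ (A t).natDegree = n ∧ ∀ z, (A t).IsRoot z → ‖z‖ = 1

/-- Cayley transform of a polynomial -/
def cay (n : ℕ) (c : ℂ) (q : ℂ[X]) : ℂ[X] :=
  C (q.eval c)⁻¹ * ∑ k ∈ Finset.range (n + 1),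
    C (q.coeff k * c ^ k) * ((X + C (-I)) ^ k * (X + C I) ^ (n - k))

theorem cay_factor (n k : ℕ) (hk : k < n + 1) :
    ((X + C (-I)) ^ k * (X + C I) ^ (n - k) : ℂ[X]).Monic ∧
    ((X + C (-I)) ^ k * (X + C I) ^ (n - k) : ℂ[X]).natDegree = n := by
  have h1 : ((X + C (-I)) ^ k : ℂ[X]).Monic := (monic_X_add_C _).pow k
  have h2 : ((X + C I) ^ (n - k) : ℂ[X]).Monic := (monic_X_add_C _).pow _
  refine ⟨h1.mul h2, ?_⟩
  rw [h1.natDegree_mul h2, natDegree_pow, natDegree_pow, natDegree_X_add_C, natDegree_X_add_C]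
  omega

theorem cay_monic (n : ℕ) (c : ℂ) (q : ℂ[X]) (hq : q.natDegree = n) (hc : q.eval c ≠ 0) :
    (cay n c q).Monic ∧ (cay n c q).natDegree = n := by
  have hle : (cay n c q).natDegree ≤ n := by
    refine (natDegree_C_mul_le _ _).trans ?_
    refine natDegree_sum_le_of_forall_le _ _ fun k hk => ?_
    refine (natDegree_C_mul_le _ _).trans ?_
    exact (cay_factor n k (Finset.mem_range.1 hk)).2.le
  have hco : (cay n c q).coeff n = 1 := by
    rw [cay, coeff_C_mul, finsetSum_coeff]
    have : ∀ k ∈ Finset.range (n + 1),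
        (C (q.coeff k * c ^ k) * ((X + C (-I)) ^ k * (X + C I) ^ (n - k)) : ℂ[X]).coeff n
          = q.coeff k * c ^ k := by
      intro k hk
      obtain ⟨h1, h2⟩ := cay_factor n k (Finset.mem_range.1 hk)
      have h3 := h1.coeff_natDegree
      rw [h2] at h3
      rw [coeff_C_mul, h3, mul_one]
    rw [Finset.sum_congr rfl this, ← eval_eq_sum_range' (by omega), inv_mul_cancel₀ hc]
  have hm := monic_of_natDegree_le_of_coeff_eq_one n hle hco
  refine ⟨hm, le_antisymm hle (le_natDegree_of_ne_zero (by rw [hco]; simp))⟩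

theorem cay_eval (n : ℕ) (c : ℂ) (q : ℂ[X]) (hq : q.natDegree = n) (x : ℂ) (hx : x + I ≠ 0) :
    (cay n c q).eval x = (q.eval c)⁻¹ * ((x + I) ^ n * q.eval (c * (x - I) / (x + I))) := by
  rw [cay, eval_mul, eval_C, eval_finsetSum]
  congr 1
  rw [eval_eq_sum_range' (show q.natDegree < n + 1 by omega), Finset.mul_sum]
  refine Finset.sum_congr rfl fun k hk => ?_
  have hk := Finset.mem_range.1 hk
  simp only [eval_mul, eval_C, eval_pow, eval_add, eval_X]
  have e : (x + I) ^ n = (x + I) ^ k * (x + I) ^ (n - k) := by rw [← pow_add]; congr 1; omega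
  rw [e, div_pow, mul_pow, ← sub_eq_add_neg]
  field_simp

theorem cay_eval_negI (n : ℕ) (c : ℂ) (hc0 : c ≠ 0) (q : ℂ[X]) (hm : q.Monic)
    (hq : q.natDegree = n) (hc : q.eval c ≠ 0) : (cay n c q).eval (-I) ≠ 0 := by
  rw [cay, eval_mul, eval_C, eval_finsetSum, Finset.sum_range_succ, Finset.sum_eq_zero]
  · have := hm.coeff_natDegree
    rw [hq] at this
    simp only [eval_mul, eval_C, eval_pow, eval_add, eval_X, this]
    refine mul_ne_zero (inv_ne_zero hc) ?_
    have : -I + -I ≠ 0 := by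
      intro h
      have := congrArg Complex.im h
      norm_num at this
    simp only [zero_add, one_mul, Nat.sub_self, pow_zero, mul_one]
    exact mul_ne_zero (pow_ne_zero _ hc0) (pow_ne_zero _ this)
  · intro k hk
    have hk := Finset.mem_range.1 hk
    simp only [eval_mul, eval_C, eval_pow, eval_add, eval_X, neg_add_cancel]
    rw [zero_pow (by omega)]; simp

theorem cay_root (n : ℕ) (c : ℂ) (hc0 : ‖c‖ = 1) (q : ℂ[X]) (hm : q.Monic)
    (hq : q.natDegree = n) (hc : q.eval c ≠ 0) (x : ℂ) :
    (cay n c q).IsRoot x ↔ x + I ≠ 0 ∧ q.IsRoot (c * (x - I) / (x + I)) := by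
  have hc1 : c ≠ 0 := by rintro rfl; simp at hc0
  by_cases hx : x + I = 0
  · have : x = -I := eq_neg_of_add_eq_zero_left hx
    simp only [hx, ne_eq, not_true_eq_false, false_and, iff_false]
    rw [this]
    exact cay_eval_negI n c hc1 q hm hq hc
  · simp only [IsRoot, cay_eval n c q hq x hx, mul_eq_zero, inv_eq_zero, hc, pow_eq_zero_iff', hx,
      ne_eq, not_false_eq_true, true_and, false_or, false_and]

theorem exists_circle_nonroot (q : ℂ[X]) (hq : q ≠ 0) : ∃ c : ℂ, ‖c‖ = 1 ∧ q.eval c ≠ 0 := by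
  have hinf : (Metric.sphere (0 : ℂ) 1).Infinite := by
    refine (isPreconnected_sphere (by simp [rank_real_complex]) (0 : ℂ) 1).infinite_of_nontrivial ?_
    exact ⟨1, by simp, -1, by simp, by norm_num⟩
  obtain ⟨c, hc, hc2⟩ := hinf.exists_notMem_finset q.roots.toFinset
  refine ⟨c, by simpa using hc, fun h => hc2 ?_⟩
  rw [Multiset.mem_toFinset, mem_roots hq]
  exact h

theorem cir_local (n : ℕ) (A : ℝ → ℂ[X]) (t0 : ℝ) (hA : CirHyp n A t0) :
    ∃ M : Multiset (ℝ → ℂ), (∀ f ∈ M, AnalyticAt ℝ f t0) ∧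
      ∀ᶠ t in 𝓝 t0, ∀ z, (A t).IsRoot z ↔ ∃ f ∈ M, z = f t := by
  obtain ⟨hAa, hAe⟩ := hA
  obtain ⟨hm0, hd0, hr0⟩ := hAe.self_of_nhds
  obtain ⟨c, hc, hcA⟩ := exists_circle_nonroot (A t0) hm0.ne_zero
  have hc1 : c ≠ 0 := by rintro rfl; simp at hc
  have hev : AnalyticAt ℝ (fun t => (A t).eval c) t0 :=
    eval_an (n + 1) hAa (hAe.mono fun t ht => by omega) analyticAt_const
  have hne : ∀ᶠ t in 𝓝 t0, (A t).eval c ≠ 0 := hev.continuousAt.eventually_ne hcA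
  have hreal : ∀ q : ℂ[X], q.Monic → q.natDegree = n → (∀ z, q.IsRoot z → ‖z‖ = 1) →
      q.eval c ≠ 0 → ∀ x, (cay n c q).IsRoot x → x.im = 0 := by
    intro q h1 h2 h3 h4 x hx
    obtain ⟨h5, h6⟩ := (cay_root n c hc q h1 h2 h4 x).1 hx
    have h7 := h3 _ h6
    rw [norm_div, norm_mul, hc, one_mul, div_eq_one_iff_eq (norm_ne_zero_iff.2 h5)] at h7
    have h8 : normSq (x - I) = normSq (x + I) := by
      rw [normSq_eq_norm_sq, normSq_eq_norm_sq, h7]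
    simp [normSq_apply] at h8
    linarith
  have hH : RelHyp n (fun t => cay n c (A t)) t0 := by
    constructor
    · intro k
      simp only [cay, coeff_C_mul, finsetSum_coeff]
      refine (hev.inv hcA).mul ?_
      apply Finset.analyticAt_fun_sum
      intro i _
      exact ((hAa i).mul analyticAt_const).mul analyticAt_const
    · filter_upwards [hAe, hne] with t h1 h2
      obtain ⟨h3, h4⟩ := cay_monic n c (A t) h1.2.1 h2
      exact ⟨h3, h4, hreal _ h1.1 h1.2.1 h1.2.2 h2⟩
  obtain ⟨M, hM, hMe⟩ := rellich n _ _ hH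
  have hroot : ∀ᶠ t in 𝓝 t0, ∀ x, (cay n c (A t)).IsRoot x ↔ ∃ f ∈ M, x = f t := by
    filter_upwards [hMe] with t ht x
    rw [IsRoot, ht, eval_multiset_prod, Multiset.prod_eq_zero_iff]
    simp [sub_eq_zero]
  refine ⟨M.map (fun f t => c * (f t - I) / (f t + I)), ?_, ?_⟩
  · intro g hg
    obtain ⟨f, hf, rfl⟩ := Multiset.mem_map.1 hg
    have h1 := (hroot.self_of_nhds (f t0)).2 ⟨f, hf, rfl⟩
    have h2 := ((cay_root n c hc _ hm0 hd0 hcA _).1 h1).1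
    have h3 := hM f hf
    exact (analyticAt_const.mul (h3.sub analyticAt_const)).div (h3.add analyticAt_const) h2
  · filter_upwards [hroot, hAe, hne] with t h1 h2 h3 z
    constructor
    · intro hz
      have hzc : c - z ≠ 0 := by
        intro h
        rw [← sub_eq_zero.1 h] at hz
        exact h3 hz
      have e1 : I * (c + z) / (c - z) + I = 2 * I * c / (c - z) := by field_simp; ring
      have e2 : I * (c + z) / (c - z) - I = 2 * I * z / (c - z) := by field_simp; ring
      have e3 : c * (I * (c + z) / (c - z) - I) / (I * (c + z) / (c - z) + I) = z := by
        rw [e1, e2]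
        have := I_ne_zero
        field_simp
      obtain ⟨f, hf, hfe⟩ := (h1 (I * (c + z) / (c - z))).1
        ((cay_root n c hc _ h2.1 h2.2.1 h3 _).2 ⟨by
          rw [e1]
          exact div_ne_zero (mul_ne_zero (mul_ne_zero two_ne_zero I_ne_zero) hc1) hzc, by
          rw [e3]; exact hz⟩)
      refine ⟨_, Multiset.mem_map.2 ⟨f, hf, rfl⟩, ?_⟩
      rw [← hfe, e3]
    · rintro ⟨g, hg, rfl⟩
      obtain ⟨f, hf, rfl⟩ := Multiset.mem_map.1 hg
      exact ((cay_root n c hc _ h2.1 h2.2.1 h3 _).1 ((h1 (f t)).2 ⟨f, hf, rfl⟩)).2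

/-- analytic germ of root at t -/
def GoodAt (A : ℝ → ℂ[X]) (f : ℝ → ℂ) (t : ℝ) : Prop :=
  AnalyticAt ℝ f t ∧ ∀ᶠ s in 𝓝 t, (A s).IsRoot (f s)

theorem GoodAt.congr {A : ℝ → ℂ[X]} {f g : ℝ → ℂ} {t : ℝ} (h : GoodAt A f t)
    (hfg : f =ᶠ[𝓝 t] g) : GoodAt A g t := by
  refine ⟨h.1.congr hfg, ?_⟩
  filter_upwards [h.2, hfg] with s h1 h2
  rwa [← h2]

theorem germ_pick {M : Multiset (ℝ → ℂ)} {f : ℝ → ℂ} {c : ℝ} (hf : AnalyticAt ℝ f c)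
    (hM : ∀ g ∈ M, AnalyticAt ℝ g c) (h : ∀ᶠ s in 𝓝 c, ∃ g ∈ M, f s = g s) :
    ∃ g ∈ M, f =ᶠ[𝓝 c] g := by
  by_contra hcon
  push Not at hcon
  have h1 : ∀ g ∈ M, ∀ᶠ s in 𝓝[≠] c, f s ≠ g s := by
    intro g hg
    rcases hf.eventually_eq_or_eventually_ne (hM g hg) with h2 | h2
    · exact absurd h2 (hcon g hg)
    · exact h2
  have h2 : ∀ᶠ s in 𝓝[≠] c, ∀ g ∈ {g | g ∈ M}, f s ≠ g s :=
    (eventually_all_finite M.finite_toSet).2 h1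
  obtain ⟨s, h3, g, h4, h5⟩ := (h2.and (eventually_nhdsWithin_of_eventually_nhds h)).exists
  exact h3 g h4 h5

theorem glob_one (n : ℕ) (hn : 1 ≤ n) (A : ℝ → ℂ[X]) (a b : ℝ) (hab : a ≤ b)
    (hA : ∀ t ∈ Set.Icc a b, CirHyp n A t) : ∃ f, ∀ t ∈ Set.Icc a b, GoodAt A f t := by
  have hloc : ∀ t : Set.Icc a b, ∃ V : Set ℝ, IsOpen V ∧ (t : ℝ) ∈ V ∧
      ∃ M : Multiset (ℝ → ℂ), ∀ s ∈ V, (∀ f ∈ M, AnalyticAt ℝ f s) ∧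
        ∀ z, (A s).IsRoot z ↔ ∃ f ∈ M, z = f s := by
    intro t
    obtain ⟨M, h1, h2⟩ := cir_local n A t (hA t t.2)
    have h3 : ∀ᶠ s in 𝓝 (t : ℝ), ∀ f ∈ {f | f ∈ M}, AnalyticAt ℝ f s :=
      (eventually_all_finite M.finite_toSet).2 fun f hf => (h1 f hf).eventually_analyticAt
    obtain ⟨V, hV, hVo, htV⟩ := eventually_nhds_iff.1 (h3.and h2)
    exact ⟨V, hVo, htV, M, hV⟩
  choose V hVo htV M hM using hloc
  have hgood : ∀ t s, s ∈ V t → ∀ f ∈ M t, GoodAt A f s := by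
    intro t s hs f hf
    refine ⟨(hM t s hs).1 f hf, ?_⟩
    filter_upwards [(hVo t).mem_nhds hs] with s' hs'
    exact ((hM t s' hs').2 _).2 ⟨f, hf, rfl⟩
  obtain ⟨t, ht0, htm, ⟨k0, hk0⟩, hcov⟩ := exists_monotone_Icc_subset_open_cover_Icc hab
    (c := fun i : Set.Icc a b => (Subtype.val ⁻¹' V i : Set (Set.Icc a b)))
    (fun i => (hVo i).preimage continuous_subtype_val)
    (fun x _ => Set.mem_iUnion.2 ⟨x, htV x⟩)
  have hind : ∀ k, ∃ f, ∀ s ∈ Set.Icc a (t k : ℝ), GoodAt A f s := by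
    intro k
    induction k with
    | zero =>
      have ha : a ∈ Set.Icc a b := ⟨le_refl _, hab⟩
      obtain ⟨hm, hd, -⟩ := (hA a ha).2.self_of_nhds
      obtain ⟨z, hz⟩ := IsAlgClosed.exists_root (A a) (by
        rw [degree_eq_natDegree hm.ne_zero, hd]; exact_mod_cast (by omega))
      obtain ⟨f, hf, -⟩ := ((hM ⟨a, ha⟩ a (htV _)).2 z).1 hz
      refine ⟨f, fun s hs => ?_⟩
      rw [ht0] at hs
      have : s = a := le_antisymm hs.2 hs.1
      rw [this]
      exact hgood ⟨a, ha⟩ a (htV _) f hf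
    | succ k ih =>
      obtain ⟨f, hf⟩ := ih
      obtain ⟨i, hi⟩ := hcov k
      set c : ℝ := (t k : ℝ) with hc
      have hcd : c ≤ (t (k + 1) : ℝ) := htm (Nat.le_succ k)
      have hcV : ∀ s, c ≤ s → s ≤ t (k + 1) → s ∈ V i := by
        intro s h1 h2
        have hs : s ∈ Set.Icc a b := ⟨(t k).2.1.trans h1, h2.trans (t (k+1)).2.2⟩
        exact hi (show (⟨s, hs⟩ : Set.Icc a b) ∈ Set.Icc (t k) (t (k+1)) from ⟨h1, h2⟩)
      have hfc := hf c ⟨(t k).2.1, le_refl _⟩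
      have hcVi := hcV c le_rfl hcd
      obtain ⟨g, hg, hfg⟩ := germ_pick hfc.1 (hM i c hcVi).1 (by
        filter_upwards [hfc.2, (hVo i).mem_nhds hcVi] with s h1 h2
        exact ((hM i s h2).2 _).1 h1)
      refine ⟨fun s => if s ≤ c then f s else g s, fun s hs => ?_⟩
      rcases lt_trichotomy s c with h | h | h
      · refine (hf s ⟨hs.1, h.le⟩).congr ?_
        filter_upwards [Iio_mem_nhds h] with x hx
        rw [if_pos (le_of_lt hx)]
      · rw [h]
        refine hfc.congr ?_
        filter_upwards [hfg] with x hx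
        split_ifs
        · rfl
        · exact hx
      · refine (hgood i s (hcV s h.le hs.2) g hg).congr ?_
        filter_upwards [Ioi_mem_nhds h] with x hx
        rw [if_neg (not_le.2 hx)]
  obtain ⟨f, hf⟩ := hind k0
  rw [hk0 k0 le_rfl] at hf
  exact ⟨f, hf⟩

theorem glob_all (n : ℕ) (a b : ℝ) (hab : a ≤ b) : ∀ A : ℝ → ℂ[X],
    (∀ t ∈ Set.Icc a b, CirHyp n A t) → ∃ μ : Fin n → ℝ → ℂ, ∀ t ∈ Set.Icc a b,
      (∀ j, AnalyticAt ℝ (μ j) t) ∧ ∀ᶠ s in 𝓝 t, A s = ∏ j, (X - C (μ j s)) := by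
  induction n with
  | zero =>
    intro A hA
    refine ⟨fun _ _ => 0, fun t ht => ⟨fun j => j.elim0, ?_⟩⟩
    filter_upwards [(hA t ht).2] with s hs
    simpa using eq_one_of_monic_natDegree_zero hs.1 hs.2.1
  | succ n ih =>
    intro A hA
    obtain ⟨f, hf⟩ := glob_one (n + 1) (by omega) A a b hab hA
    have hfac : ∀ t ∈ Set.Icc a b, ∀ᶠ s in 𝓝 t,
        (X - C (f s)) * (A s /ₘ (X - C (f s))) = A s := by
      intro t ht
      filter_upwards [(hf t ht).2] with s hs
      exact mul_divByMonic_eq_iff_isRoot.2 hs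
    obtain ⟨μ, hμ⟩ := ih (fun s => A s /ₘ (X - C (f s))) (by
      intro t ht
      constructor
      · intro k
        have h1 : AnalyticAt ℝ (fun s => ∑ i ∈ Finset.Icc (k + 1) (n + 1),
            f s ^ (i - (k + 1)) * (A s).coeff i) t := by
          apply Finset.analyticAt_fun_sum
          intro i _
          exact ((hf t ht).1.pow _).mul ((hA t ht).1 i)
        refine h1.congr ?_
        filter_upwards [(hA t ht).2] with s hs
        rw [coeff_divByMonic_X_sub_C, hs.2.1]
      · filter_upwards [(hA t ht).2, hfac t ht] with s h1 h2
        have hm : (A s /ₘ (X - C (f s))).Monic :=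
          (monic_X_sub_C (f s)).of_mul_monic_left (by rw [h2]; exact h1.1)
        refine ⟨hm, ?_, ?_⟩
        · have := h1.2.1
          rw [← h2, (monic_X_sub_C (f s)).natDegree_mul hm, natDegree_X_sub_C] at this
          omega
        · intro z hz
          refine h1.2.2 z ?_
          rw [← h2, IsRoot, eval_mul, hz.eq_zero, mul_zero])
    refine ⟨Fin.cons f μ, fun t ht => ⟨?_, ?_⟩⟩
    · intro j
      refine Fin.cases ?_ (fun j => ?_) j
      · simpa using (hf t ht).1
      · simpa using (hμ t ht).1 j
    · filter_upwards [hfac t ht, (hμ t ht).2] with s h1 h2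
      rw [Fin.prod_univ_succ]
      simp only [Fin.cons_zero, Fin.cons_succ]
      rw [← h2, h1]

/-- zero-free on the disc -/
def ZF (q : ℂ[X]) : Prop := ∀ w : ℂ, ‖w‖ < 1 → q.eval w ≠ 0

/-- exact degree n with all roots on the circle -/
def Circ (n : ℕ) (P : ℂ[X]) : Prop := P ≠ 0 ∧ P.natDegree = n ∧ ∀ z, P.IsRoot z → ‖z‖ = 1

theorem norm_eval_roots (q : ℂ[X]) (x : ℂ) :
    ‖q.eval x‖ = ‖q.leadingCoeff‖ * (q.roots.map fun b => ‖x - b‖).prod := by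
  have h := (IsAlgClosed.splits q).eq_prod_roots
  conv_lhs => rw [h]
  rw [eval_mul, eval_C, norm_mul, eval_multiset_prod]
  congr 1
  rw [← normHom_apply, map_multiset_prod]
  simp [Multiset.map_map, Function.comp_def]

theorem card_roots_nd (q : ℂ[X]) : q.roots.card = q.natDegree :=
  ((IsAlgClosed.splits q).natDegree_eq_card_roots).symm

theorem ZF.root {q : ℂ[X]} (h : ZF q) {b : ℂ} (hb : b ∈ q.roots) : 1 ≤ ‖b‖ := by
  by_contra hc
  exact h b (not_le.1 hc) (isRoot_of_mem_roots hb)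

theorem mprod_const_mul (s : Multiset ℂ) (c : ℝ) (f : ℂ → ℝ) :
    (s.map fun b => c * f b).prod = c ^ s.card * (s.map f).prod := by
  rw [Multiset.prod_map_mul]; simp

theorem mprod_le (s : Multiset ℂ) (f g : ℂ → ℝ) (hf : ∀ b ∈ s, 0 ≤ f b)
    (h : ∀ b ∈ s, f b ≤ g b) : (s.map f).prod ≤ (s.map g).prod :=
  Multiset.prod_map_le_prod_map₀ f g hf h

theorem zf_lower {q : ℂ[X]} (h : ZF q) {n : ℕ} (hn : q.natDegree ≤ n) {w : ℂ} (hw : ‖w‖ < 1) :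
    (1 - ‖w‖) ^ n * ‖q.eval 0‖ ≤ ‖q.eval w‖ := by
  rw [norm_eval_roots, norm_eval_roots q w]
  have h1 := mprod_le q.roots (fun b => (1 - ‖w‖) * ‖0 - b‖) (fun b => ‖w - b‖)
    (fun b _ => mul_nonneg (by linarith) (norm_nonneg _)) (by
      intro b hb
      have h2 := h.root hb
      have h3 := norm_sub_norm_le b w
      rw [norm_sub_rev] at h3
      simp only [zero_sub, norm_neg]
      nlinarith [norm_nonneg w])
  rw [mprod_const_mul, card_roots_nd] at h1
  have h3 : (1 - ‖w‖) ^ n ≤ (1 - ‖w‖) ^ q.natDegree :=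
    pow_le_pow_of_le_one (by linarith) (by linarith [norm_nonneg w]) hn
  have h4 : 0 ≤ (q.roots.map fun b => ‖0 - b‖).prod :=
    Multiset.prod_nonneg (by simp only [Multiset.mem_map]; rintro a ⟨b, -, rfl⟩; positivity)
  calc _ = ‖q.leadingCoeff‖ * ((1 - ‖w‖) ^ n * (q.roots.map fun b => ‖0 - b‖).prod) := by ring
    _ ≤ ‖q.leadingCoeff‖ * ((1 - ‖w‖) ^ q.natDegree * (q.roots.map fun b => ‖0 - b‖).prod) := by
      gcongr
    _ ≤ _ := by gcongr

theorem zf_upper {q : ℂ[X]} (h : ZF q) {n : ℕ} (hn : q.natDegree ≤ n) {w : ℂ} (hw : ‖w‖ < 1) :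
    ‖q.eval w‖ ≤ 2 ^ n * ‖q.eval 0‖ := by
  rw [norm_eval_roots, norm_eval_roots q 0]
  have h1 := mprod_le q.roots (fun b => ‖w - b‖) (fun b => 2 * ‖0 - b‖)
    (fun b _ => norm_nonneg _) (by
      intro b hb
      have h2 := h.root hb
      have h3 := norm_sub_le w b
      simp only [zero_sub, norm_neg]
      linarith)
  rw [mprod_const_mul, card_roots_nd] at h1
  have h3 : (2 : ℝ) ^ q.natDegree ≤ 2 ^ n := pow_le_pow_right₀ (by norm_num) hn
  have h4 : 0 ≤ (q.roots.map fun b => ‖0 - b‖).prod :=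
    Multiset.prod_nonneg (by simp only [Multiset.mem_map]; rintro a ⟨b, -, rfl⟩; positivity)
  calc _ ≤ ‖q.leadingCoeff‖ * (2 ^ q.natDegree * (q.roots.map fun b => ‖0 - b‖).prod) := by
        gcongr
    _ ≤ ‖q.leadingCoeff‖ * (2 ^ n * (q.roots.map fun b => ‖0 - b‖).prod) := by gcongr
    _ = _ := by ring

theorem hurwitz {ι : Type*} {l : Filter ι} [l.NeBot] {Q : ι → ℂ[X]} {q : ℂ[X]} (n : ℕ)
    (hQ : ∀ᶠ k in l, (Q k).natDegree ≤ n ∧ ZF (Q k))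
    (hlim : ∀ w, Tendsto (fun k => (Q k).eval w) l (𝓝 (q.eval w))) : q = 0 ∨ ZF q := by
  have h1 : ∀ w : ℂ, ‖w‖ < 1 → (1 - ‖w‖) ^ n * ‖q.eval 0‖ ≤ ‖q.eval w‖ := fun w hw =>
    le_of_tendsto_of_tendsto ((hlim 0).norm.const_mul _) (hlim w).norm
      (hQ.mono fun k hk => zf_lower hk.2 hk.1 hw)
  have h2 : ∀ w : ℂ, ‖w‖ < 1 → ‖q.eval w‖ ≤ 2 ^ n * ‖q.eval 0‖ := fun w hw =>
    le_of_tendsto_of_tendsto (hlim w).norm ((hlim 0).norm.const_mul _)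
      (hQ.mono fun k hk => zf_upper hk.2 hk.1 hw)
  by_cases h0 : q.eval 0 = 0
  · left
    refine eq_zero_of_infinite_isRoot q ?_
    refine Set.Infinite.mono (s := Metric.ball 0 1) ?_ ?_
    · intro w hw
      have := h2 w (by simpa using hw)
      rw [h0] at this
      simpa using this
    · exact infinite_of_mem_nhds (0 : ℂ) (Metric.ball_mem_nhds _ one_pos)
  · right
    intro w hw hz
    have h3 := h1 w hw
    rw [hz, norm_zero] at h3
    have : 0 < (1 - ‖w‖) ^ n * ‖q.eval 0‖ :=
      mul_pos (pow_pos (by linarith) _) (norm_pos_iff.2 h0)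
    linarith

theorem norm_star_sub (w b : ℂ) (hw : w ≠ 0) :
    ‖w‖ * ‖((starRingEnd ℂ) w)⁻¹ - b‖ = ‖1 - (starRingEnd ℂ) w * b‖ := by
  have h : (starRingEnd ℂ) w ≠ 0 := by simpa using hw
  rw [← Complex.norm_conj w, ← norm_mul, mul_sub, mul_inv_cancel₀ h]

theorem normSq_id (w b : ℂ) :
    ‖1 - (starRingEnd ℂ) w * b‖ ^ 2 + (1 - ‖w‖ ^ 2) * (‖b‖ ^ 2 - 1) = ‖w - b‖ ^ 2 := by
  simp only [← normSq_eq_norm_sq, normSq_apply]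
  simp
  ring

theorem blaschke {q : ℂ[X]} (h : ZF q) {n : ℕ} (hn : q.natDegree ≤ n) {w : ℂ} (hw : ‖w‖ < 1)
    (hw0 : w ≠ 0) : ‖w‖ ^ n * ‖q.eval ((starRingEnd ℂ) w)⁻¹‖ ≤ ‖q.eval w‖ := by
  rw [norm_eval_roots, norm_eval_roots q w]
  have h1 := mprod_le q.roots (fun b => ‖w‖ * ‖((starRingEnd ℂ) w)⁻¹ - b‖) (fun b => ‖w - b‖)
    (fun b _ => by positivity) (by
      intro b hb
      have h2 := h.root hb
      rw [norm_star_sub w b hw0]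
      refine abs_le_of_sq_le_sq' ?_ (norm_nonneg _) |>.2
      have h4 : 0 ≤ 1 - ‖w‖ ^ 2 := by nlinarith [norm_nonneg w]
      have h5 : 0 ≤ ‖b‖ ^ 2 - 1 := by nlinarith
      nlinarith [normSq_id w b, mul_nonneg h4 h5])
  rw [mprod_const_mul, card_roots_nd] at h1
  have h3 : ‖w‖ ^ n ≤ ‖w‖ ^ q.natDegree := pow_le_pow_of_le_one (norm_nonneg _) hw.le hn
  have h4 : 0 ≤ (q.roots.map fun b => ‖((starRingEnd ℂ) w)⁻¹ - b‖).prod :=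
    Multiset.prod_nonneg (by simp only [Multiset.mem_map]; rintro a ⟨b, -, rfl⟩; positivity)
  calc _ = ‖q.leadingCoeff‖ * (‖w‖ ^ n * (q.roots.map fun b => ‖((starRingEnd ℂ) w)⁻¹ - b‖).prod) := by ring
    _ ≤ ‖q.leadingCoeff‖ * (‖w‖ ^ q.natDegree * (q.roots.map fun b => ‖((starRingEnd ℂ) w)⁻¹ - b‖).prod) := by
      gcongr
    _ ≤ _ := by gcongr

theorem circ_sym {P : ℂ[X]} {n : ℕ} (hP : Circ n P) {w : ℂ} (hw0 : w ≠ 0) :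
    ‖P.eval w‖ = ‖w‖ ^ n * ‖P.eval ((starRingEnd ℂ) w)⁻¹‖ := by
  rw [norm_eval_roots, norm_eval_roots P ((starRingEnd ℂ) w)⁻¹, mul_left_comm]
  congr 1
  rw [← hP.2.1, ← card_roots_nd, ← mprod_const_mul]
  congr 1
  refine Multiset.map_congr rfl fun b hb => ?_
  have h1 := hP.2.2 b (isRoot_of_mem_roots hb)
  rw [norm_star_sub w b hw0]
  have := normSq_id w b
  rw [h1] at this
  have h2 : ‖1 - (starRingEnd ℂ) w * b‖ ^ 2 = ‖w - b‖ ^ 2 := by linarith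
  exact ((sq_eq_sq₀ (norm_nonneg _) (norm_nonneg _)).1 h2).symm

theorem circ_of_sym {P : ℂ[X]} {n : ℕ} (hP : P ≠ 0) (hz : ZF P)
    (hs : ∀ w : ℂ, w ≠ 0 → ‖P.eval w‖ = ‖w‖ ^ n * ‖P.eval ((starRingEnd ℂ) w)⁻¹‖) : Circ n P := by
  have hroot : ∀ z, P.IsRoot z → ‖z‖ = 1 := by
    intro z hzr
    have h1 : 1 ≤ ‖z‖ := hz.root ((mem_roots hP).2 hzr)
    have h0 : z ≠ 0 := by rintro rfl; norm_num at h1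
    have h2 := hs z h0
    rw [hzr.eq_zero, norm_zero] at h2
    have h3 : P.IsRoot ((starRingEnd ℂ) z)⁻¹ := by
      have := (mul_eq_zero.1 h2.symm).resolve_left (pow_ne_zero _ (norm_ne_zero_iff.2 h0))
      exact norm_eq_zero.1 this
    have h4 : 1 ≤ ‖((starRingEnd ℂ) z)⁻¹‖ := hz.root ((mem_roots hP).2 h3)
    rw [norm_inv, Complex.norm_conj] at h4
    exact le_antisymm ((one_le_inv₀ (by positivity)).1 h4) h1
  refine ⟨hP, ?_, hroot⟩
  have h1 := circ_sym (n := P.natDegree) ⟨hP, rfl, hroot⟩ (w := 2) two_ne_zero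
  have h2 := hs 2 two_ne_zero
  have h3 : ‖P.eval ((starRingEnd ℂ) 2)⁻¹‖ ≠ 0 := norm_ne_zero_iff.2 (hz _ (by
    rw [norm_inv, Complex.norm_conj]; norm_num))
  rw [h1] at h2
  have h4 := mul_right_cancel₀ h3 h2
  exact Nat.pow_right_injective (le_refl 2) (by
    have : ((2 : ℝ)) ^ P.natDegree = 2 ^ n := by simpa using h4
    exact_mod_cast this)

theorem circ_limit {ι : Type*} {l : Filter ι} [l.NeBot] {Q : ι → ℂ[X]} {q : ℂ[X]} {n : ℕ}
    (hQ : ∀ᶠ k in l, Circ n (Q k)) (hq : q ≠ 0)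
    (hlim : ∀ w, Tendsto (fun k => (Q k).eval w) l (𝓝 (q.eval w))) : Circ n q := by
  refine circ_of_sym hq ((hurwitz n ?_ hlim).resolve_left hq) ?_
  · filter_upwards [hQ] with k hk
    refine ⟨hk.2.1.le, fun w hw hz => ?_⟩
    have := hk.2.2 w hz
    linarith
  · intro w hw
    refine tendsto_nhds_unique_of_eventuallyEq (hlim w).norm ((hlim _).norm.const_mul _) ?_
    filter_upwards [hQ] with k hk
    exact circ_sym hk hw

theorem circ_pencil {q qt : ℂ[X]} {n : ℕ} {c α : ℂ} (hz : ZF q) (hn : q.natDegree ≤ n)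
    (hc : ‖c‖ = 1) (hα : ‖α‖ = 1)
    (hr : ∀ w : ℂ, w ≠ 0 → qt.eval w = c * w ^ n * (starRingEnd ℂ) (q.eval ((starRingEnd ℂ) w)⁻¹))
    (hP : qt - C α * q ≠ 0) : Circ n (qt - C α * q) := by
  have hle' : ∀ w : ℂ, ‖w‖ < 1 → w ≠ 0 → ‖qt.eval w‖ ≤ ‖q.eval w‖ := by
    intro w hw hw0
    rw [hr w hw0, norm_mul, norm_mul, hc, one_mul, norm_pow, Complex.norm_conj]
    exact blaschke hz hn hw hw0
  have hle : ∀ w : ℂ, ‖w‖ < 1 → ‖qt.eval w‖ ≤ ‖q.eval w‖ := by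
    intro w hw
    by_cases hw0 : w = 0
    · rw [hw0]
      refine le_of_tendsto_of_tendsto (b := 𝓝[≠] (0 : ℂ))
        ((qt.continuous.norm.tendsto 0).mono_left nhdsWithin_le_nhds)
        ((q.continuous.norm.tendsto 0).mono_left nhdsWithin_le_nhds) ?_
      filter_upwards [self_mem_nhdsWithin,
        mem_nhdsWithin_of_mem_nhds (Metric.ball_mem_nhds (0 : ℂ) one_pos)] with x h1 h2
      exact hle' x (by simpa using h2) h1
    · exact hle' w hw hw0
  have hzf : ZF (qt - C α * q) := by
    refine (hurwitz (l := 𝓝[>] (1 : ℝ)) (Q := fun r => qt - C ((r : ℂ) * α) * q)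
      (max qt.natDegree q.natDegree) ?_ ?_).resolve_left hP
    · filter_upwards [self_mem_nhdsWithin] with r hr1
      have hr1 : 1 < r := hr1
      constructor
      · refine (natDegree_sub_le _ _).trans (max_le_max le_rfl (natDegree_C_mul_le _ _))
      · intro w hw h0
        simp only [eval_sub, eval_mul, eval_C, sub_eq_zero] at h0
        have h1 := hle w hw
        have h2 := norm_pos_iff.2 (hz w hw)
        rw [h0, norm_mul, norm_mul, hα, mul_one, norm_real, Real.norm_eq_abs,
          abs_of_pos (by linarith)] at h1
        nlinarith
    · intro w
      refine Tendsto.mono_left ?_ nhdsWithin_le_nhds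
      have : Continuous fun r : ℝ => (qt - C ((r : ℂ) * α) * q).eval w := by
        simp only [eval_sub, eval_mul, eval_C]
        fun_prop
      simpa using this.tendsto 1
  refine circ_of_sym hP hzf ?_
  intro w hw
  have hcw : (starRingEnd ℂ) w ≠ 0 := by simpa using hw
  have e1 := hr w hw
  have e2 := hr ((starRingEnd ℂ) w)⁻¹ (inv_ne_zero hcw)
  have hcc : c * (starRingEnd ℂ) c = 1 := by rw [mul_conj, normSq_eq_norm_sq, hc]; norm_num
  have haa : α * (starRingEnd ℂ) α = 1 := by rw [mul_conj, normSq_eq_norm_sq, hα]; norm_num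
  have key : (qt - C α * q).eval w = -α * c * w ^ n *
      (starRingEnd ℂ) ((qt - C α * q).eval ((starRingEnd ℂ) w)⁻¹) := by
    simp only [eval_sub, eval_mul, eval_C]
    rw [e2, e1]
    simp only [map_sub, map_mul, map_pow, map_inv₀, conj_conj, inv_inv]
    have : w ^ n * (w⁻¹) ^ n = 1 := by rw [← mul_pow, mul_inv_cancel₀ hw, one_pow]
    linear_combination (-(c * w ^ n * (starRingEnd ℂ) (q.eval ((starRingEnd ℂ) w)⁻¹))) * haa +
      α * q.eval w * this * c * (starRingEnd ℂ) c + α * q.eval w * hcc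
  rw [key]
  simp only [norm_mul, norm_neg, hα, hc, one_mul, norm_pow, Complex.norm_conj]

/-- choice of gcd structure -/
@[reducible] def ngm : NormalizedGCDMonoid ℂ[X] := UniqueFactorizationMonoid.toNormalizedGCDMonoid ℂ[X]

theorem prim_fac (f : ℂ[X][X]) (hf : f ≠ 0) :
    ∃ (c : ℂ[X]) (R : ℂ[X][X]), c ≠ 0 ∧ R.IsPrimitive ∧ f = C c * R := by
  let := ngm
  refine ⟨f.content, f.primPart, ?_, f.isPrimitive_primPart, f.eq_C_content_mul_primPart⟩
  rwa [Ne, content_eq_zero_iff]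

theorem clear_den (a : (FractionRing ℂ[X])[X]) : ∃ (c : ℂ[X]) (b : ℂ[X][X]), c ≠ 0 ∧
    b.map (algebraMap ℂ[X] (FractionRing ℂ[X])) = C (algebraMap ℂ[X] (FractionRing ℂ[X]) c) * a := by
  obtain ⟨b, hbm, hb⟩ := IsLocalization.integerNormalization_spec (nonZeroDivisors ℂ[X]) a
  refine ⟨b, _, nonZeroDivisors.ne_zero hbm, hb.trans ?_⟩
  rw [Algebra.smul_def]
  rfl

theorem bez (f g : ℂ[X][X]) (hf : f ≠ 0) (h : ∀ r, r ∣ f → r ∣ g → IsUnit r) :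
    ∃ (u v : ℂ[X][X]) (d : ℂ[X]), d ≠ 0 ∧ u * f + v * g = C d := by
  set φ := algebraMap ℂ[X] (FractionRing ℂ[X]) with hφ
  have hinj : Function.Injective φ := IsFractionRing.injective _ _
  have hminj := Polynomial.map_injective φ hinj
  by_cases hc : IsCoprime (f.map φ) (g.map φ)
  · obtain ⟨a, b, hab⟩ := hc
    obtain ⟨c, a', hc0, ha⟩ := clear_den a
    obtain ⟨d, b', hd0, hb⟩ := clear_den b
    refine ⟨C d * a', C c * b', c * d, mul_ne_zero hc0 hd0, hminj ?_⟩
    simp only [Polynomial.map_add, Polynomial.map_mul, Polynomial.map_C, map_mul]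
    rw [ha, hb]
    linear_combination C (φ c) * C (φ d) * hab
  · exfalso
    set G := EuclideanDomain.gcd (f.map φ) (g.map φ) with hG
    have hGu : ¬ IsUnit G := fun hu => hc (EuclideanDomain.gcd_isUnit_iff.1 hu)
    have hf0 : f.map φ ≠ 0 := fun h0 => hf (hminj (by simpa using h0))
    have hG0 : G ≠ 0 := fun h0 => hf0 (EuclideanDomain.gcd_eq_zero_iff.1 h0).1
    obtain ⟨c, G', hc0, hG'⟩ := clear_den G
    have hcu : IsUnit (C (φ c) : (FractionRing ℂ[X])[X]) := by
      rw [isUnit_C]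
      exact (IsUnit.mk0 _ ((map_ne_zero_iff φ hinj).2 hc0))
    have hG'0 : G' ≠ 0 := by
      rintro rfl
      rw [Polynomial.map_zero] at hG'
      exact mul_ne_zero hcu.ne_zero hG0 hG'.symm
    obtain ⟨e, R, he, hR, hGR⟩ := prim_fac G' hG'0
    have heu : IsUnit (C (φ e) : (FractionRing ℂ[X])[X]) := by
      rw [isUnit_C]
      exact (IsUnit.mk0 _ ((map_ne_zero_iff φ hinj).2 he))
    rw [hGR, Polynomial.map_mul, Polynomial.map_C] at hG'
    have hdvd : R.map φ ∣ G := by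
      rw [← hcu.dvd_mul_left, ← hG']
      exact dvd_mul_left _ _
    let := ngm
    have h1 := hR.dvd_of_fraction_map_dvd_fraction_map (K := FractionRing ℂ[X])
      (hdvd.trans (EuclideanDomain.gcd_dvd_left _ _))
    have h2 := hR.dvd_of_fraction_map_dvd_fraction_map (K := FractionRing ℂ[X])
      (hdvd.trans (EuclideanDomain.gcd_dvd_right _ _))
    have h3 := (h R h1 h2).map (mapRingHom φ)
    apply hGu
    refine isUnit_of_mul_isUnit_right (x := C (φ c)) ?_
    rw [← hG']
    exact heu.mul h3

/-- bivariate form -/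
def biv : MvPolynomial (Fin 2) ℂ →ₐ[ℂ] ℂ[X][X] := MvPolynomial.aeval ![C X, X]

/-- inverse -/
def unbiv : ℂ[X][X] →ₐ[ℂ] MvPolynomial (Fin 2) ℂ :=
  aevalAeval (MvPolynomial.X 0) (MvPolynomial.X 1)

theorem unbiv_biv (p : MvPolynomial (Fin 2) ℂ) : unbiv (biv p) = p := by
  have : unbiv.comp biv = AlgHom.id ℂ _ := by
    apply MvPolynomial.algHom_ext
    intro i
    fin_cases i <;> simp [biv, unbiv]
  exact DFunLike.congr_fun this p

theorem biv_unbiv (r : ℂ[X][X]) : biv (unbiv r) = r := by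
  have : biv.comp unbiv = AlgHom.id ℂ _ := by
    ext <;> simp [biv, unbiv]
  exact DFunLike.congr_fun this r

/-- section at fixed first variable -/
def sec (f : ℂ[X][X]) (ζ : ℂ) : ℂ[X] := f.map (evalRingHom ζ)

theorem sec_biv_eval (p : MvPolynomial (Fin 2) ℂ) (ζ w : ℂ) :
    (sec (biv p) ζ).eval w = MvPolynomial.eval ![ζ, w] p := by
  rw [sec, eval_map, biv, MvPolynomial.aeval_def, ← coe_eval₂RingHom, MvPolynomial.hom_eval₂,
    MvPolynomial.eval, MvPolynomial.coe_eval₂Hom]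
  congr 1
  · ext; simp
  · funext i
    fin_cases i <;> simp

theorem biv_natDegree (p : MvPolynomial (Fin 2) ℂ) :
    (biv p).natDegree ≤ MvPolynomial.degreeOf 1 p := by
  rw [biv, MvPolynomial.aeval_def, MvPolynomial.eval₂_eq']
  refine natDegree_sum_le_of_forall_le _ _ fun s hs => ?_
  rw [Fin.prod_univ_two]
  have e : (algebraMap ℂ ℂ[X][X]) (MvPolynomial.coeff s p) = C (C (MvPolynomial.coeff s p)) := rfl
  simp only [Matrix.cons_val_zero, Matrix.cons_val_one, e]
  rw [← C_pow, ← mul_assoc, ← C_mul]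
  refine (natDegree_C_mul_le _ _).trans ?_
  rw [natDegree_X_pow]
  exact MvPolynomial.monomial_le_degreeOf 1 hs

theorem sec_natDegree (f : ℂ[X][X]) (ζ : ℂ) : (sec f ζ).natDegree ≤ f.natDegree :=
  natDegree_map_le

theorem sec_eq_zero {f : ℂ[X][X]} {ζ : ℂ} (h : sec f ζ = 0) : C (X - C ζ) ∣ f := by
  rw [C_dvd_iff_dvd_coeff]
  intro i
  rw [dvd_iff_isRoot]
  have := congrArg (fun q => q.coeff i) h
  simpa [sec] using this

theorem sec_coeff (f : ℂ[X][X]) (ζ : ℂ) (k : ℕ) : (sec f ζ).coeff k = (f.coeff k).eval ζ := by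
  simp [sec]

theorem sec_cont (f : ℂ[X][X]) : Continuous fun z : ℂ × ℂ => (sec f z.1).eval z.2 := by
  simp only [sec, eval_map, eval₂_eq_sum_range]
  refine continuous_finsetSum _ fun i _ => ?_
  refine Continuous.mul ?_ (by fun_prop)
  simp only [coe_evalRingHom]
  exact (f.coeff i).continuous.comp continuous_fst

theorem ev_sec (p : MvPolynomial (Fin 2) ℂ) (ζ w : ℂ) : ev p (ζ, w) = (sec (biv p) ζ).eval w :=
  (sec_biv_eval p ζ w).symm

theorem conj_inv_of_norm {ζ : ℂ} (h : ‖ζ‖ = 1) : ((starRingEnd ℂ) ζ)⁻¹ = ζ := by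
  have : ζ * (starRingEnd ℂ) ζ = 1 := by rw [mul_conj, normSq_eq_norm_sq, h]; norm_num
  exact inv_eq_of_mul_eq_one_left this

theorem exp_norm (θ : ℝ) : ‖Complex.exp ((θ : ℂ) * I)‖ = 1 := Complex.norm_exp_ofReal_mul_I θ

theorem exp_ne (θ : ℝ) : Tendsto (fun t : ℝ => Complex.exp ((t : ℂ) * I)) (𝓝[≠] θ)
    (𝓝[≠] Complex.exp ((θ : ℂ) * I)) := by
  have h : HasDerivAt (fun t : ℝ => Complex.exp ((t : ℂ) * I))
      (Complex.exp ((θ : ℂ) * I) * (1 * I)) θ :=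
    (((hasDerivAt_id (θ : ℂ)).mul_const I).cexp).comp_ofReal
  exact h.tendsto_nhdsNE (mul_ne_zero (Complex.exp_ne_zero _) (by simp))

theorem poly_ne (d : ℂ[X]) (hd : d ≠ 0) (z : ℂ) : ∀ᶠ x in 𝓝[≠] z, d.eval x ≠ 0 := by
  have hfin : ((d.roots.toFinset : Set ℂ) \ {z}).Finite := (Finset.finite_toSet _).sdiff
  have h1 : ((d.roots.toFinset : Set ℂ) \ {z})ᶜ ∈ 𝓝 z := hfin.isClosed.isOpen_compl.mem_nhds (by simp)
  filter_upwards [mem_nhdsWithin_of_mem_nhds h1, self_mem_nhdsWithin] with x h2 h3 h4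
  exact h2 ⟨by simpa [hd] using h4, h3⟩

theorem poly_ne_exp (d : ℂ[X]) (hd : d ≠ 0) (θ : ℝ) :
    ∀ᶠ t : ℝ in 𝓝[≠] θ, d.eval (Complex.exp ((t : ℂ) * I)) ≠ 0 :=
  (exp_ne θ).eventually (poly_ne d hd _)

section
variable {m n : ℕ} {p pt : MvPolynomial (Fin 2) ℂ}

theorem rif_cop (h : IsRIF2 m n p pt) (r : ℂ[X][X]) (h1 : r ∣ biv p) (h2 : r ∣ biv pt) :
    IsUnit r := by
  have e1 := map_dvd unbiv h1
  have e2 := map_dvd unbiv h2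
  rw [unbiv_biv] at e1 e2
  have := (h.coprime _ e1 e2).map biv
  rwa [biv_unbiv] at this

theorem rif_refl (h : IsRIF2 m n p pt) {ζ : ℂ} (hζ : ‖ζ‖ = 1) (w : ℂ) (hw : w ≠ 0) :
    (sec (biv pt) ζ).eval w =
      ζ ^ m * w ^ n * (starRingEnd ℂ) ((sec (biv p) ζ).eval ((starRingEnd ℂ) w)⁻¹) := by
  have h0 : ζ ≠ 0 := by rintro rfl; simp at hζ
  have := h.reflection (ζ, w) h0 hw
  simp only [ev_sec, conj_inv_of_norm hζ] at this
  exact this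

theorem rif_sec_ne (h : IsRIF2 m n p pt) {ζ : ℂ} (hζ : ‖ζ‖ = 1) : sec (biv p) ζ ≠ 0 := by
  intro h0
  have h1 : sec (biv pt) ζ = 0 := by
    refine eq_zero_of_infinite_isRoot _ ?_
    refine Set.Infinite.mono (s := {0}ᶜ) ?_ (Set.finite_singleton (0 : ℂ)).infinite_compl
    intro w hw
    have := rif_refl h hζ w hw
    rw [h0] at this
    simpa using this
  have := rif_cop h _ (sec_eq_zero h0) (sec_eq_zero h1)
  rw [isUnit_C] at this
  exact not_isUnit_X_sub_C ζ this

theorem rif_zf (h : IsRIF2 m n p pt) {ζ : ℂ} (hζ : ‖ζ‖ = 1) : ZF (sec (biv p) ζ) := by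
  refine (hurwitz (l := 𝓝[<] (1 : ℝ)) (Q := fun r => sec (biv p) ((r : ℂ) * ζ))
    (biv p).natDegree ?_ ?_).resolve_left (rif_sec_ne h hζ)
  · have : ∀ᶠ r : ℝ in 𝓝[<] (1 : ℝ), 0 < r :=
      mem_nhdsWithin_of_mem_nhds (Ioi_mem_nhds one_pos)
    filter_upwards [self_mem_nhdsWithin, this] with r hr hr0
    refine ⟨sec_natDegree _ _, fun w hw => ?_⟩
    rw [← ev_sec]
    refine h.stable _ ⟨?_, hw⟩
    simp only [norm_mul, hζ, norm_real, Real.norm_eq_abs, abs_of_pos hr0, mul_one]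
    exact hr
  · intro w
    refine Tendsto.mono_left ?_ nhdsWithin_le_nhds
    have : Continuous fun r : ℝ => (sec (biv p) ((r : ℂ) * ζ)).eval w :=
      (sec_cont (biv p)).comp (g := fun z : ℂ × ℂ => (sec (biv p) z.1).eval z.2)
        (f := fun r : ℝ => ((r : ℂ) * ζ, w)) (by fun_prop)
    simpa using this.tendsto 1

theorem rif_not_unit (h : IsRIF2 m n p pt) : ¬ IsUnit (biv p) := by
  intro hu
  have := hu.map unbiv
  rw [unbiv_biv, MvPolynomial.isUnit_iff_eq_C_of_isReduced] at this
  obtain ⟨c, -, hc⟩ := this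
  have h1 := h.deg1
  have h2 := h.hm
  rw [hc, MvPolynomial.degreeOf_C] at h1
  omega

theorem rif_fac (h : IsRIF2 m n p pt) {α : ℂ} (hα : ‖α‖ = 1) :
    ∃ (c : ℂ[X]) (R : ℂ[X][X]), c ≠ 0 ∧ (∀ ζ, ‖ζ‖ = 1 → Circ n (sec R ζ)) ∧
      ∀ ζ w, ev pt (ζ, w) - α * ev p (ζ, w) = c.eval ζ * (sec R ζ).eval w := by
  have hP : biv pt - C (C α) * biv p ≠ 0 := by
    intro h0
    rw [sub_eq_zero] at h0
    exact rif_not_unit h (rif_cop h _ dvd_rfl (by rw [h0]; exact dvd_mul_left _ _))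
  obtain ⟨c, R, hc, hR, hcR⟩ := prim_fac _ hP
  have hsec : ∀ ζ, sec (biv pt) ζ - C α * sec (biv p) ζ = C (c.eval ζ) * sec R ζ := by
    intro ζ
    have := congrArg (fun f => sec f ζ) hcR
    simpa [sec] using this
  have hRne : ∀ ζ, sec R ζ ≠ 0 := by
    intro ζ h0
    exact not_isUnit_X_sub_C ζ (hR _ (sec_eq_zero h0))
  have hgen : ∀ ζ, ‖ζ‖ = 1 → c.eval ζ ≠ 0 → Circ n (sec R ζ) := by
    intro ζ hζ hcζ
    have h1 : C (c.eval ζ) * sec R ζ ≠ 0 := mul_ne_zero (by simpa using hcζ) (hRne ζ)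
    have h2 := circ_pencil (q := sec (biv p) ζ) (qt := sec (biv pt) ζ) (n := n) (c := ζ ^ m)
      (rif_zf h hζ) ((sec_natDegree _ _).trans ((biv_natDegree p).trans h.deg2.le))
      (by rw [norm_pow, hζ, one_pow]) hα (rif_refl h hζ) (by rw [hsec]; exact h1)
    rw [hsec] at h2
    refine ⟨hRne ζ, ?_, ?_⟩
    · rw [← h2.2.1, natDegree_C_mul hcζ]
    · intro z hz
      refine h2.2.2 z ?_
      rw [IsRoot, eval_mul, hz.eq_zero, mul_zero]
  refine ⟨c, R, hc, ?_, ?_⟩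
  · intro ζ hζ
    have hζe : Complex.exp ((arg ζ : ℂ) * I) = ζ := by
      have := norm_mul_exp_arg_mul_I ζ
      rwa [hζ, ofReal_one, one_mul] at this
    refine circ_limit (l := 𝓝[≠] (arg ζ)) (Q := fun t : ℝ => sec R (Complex.exp ((t : ℂ) * I)))
      ?_ (hRne ζ) ?_
    · filter_upwards [poly_ne_exp c hc (arg ζ)] with t ht
      exact hgen _ (exp_norm t) ht
    · intro w
      refine Tendsto.mono_left ?_ nhdsWithin_le_nhds
      have : Continuous fun t : ℝ => (sec R (Complex.exp ((t : ℂ) * I))).eval w :=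
        (sec_cont R).comp (g := fun z : ℂ × ℂ => (sec R z.1).eval z.2)
          (f := fun t : ℝ => (Complex.exp ((t : ℂ) * I), w)) (by fun_prop)
      have h2 := this.tendsto (arg ζ)
      simp only [hζe] at h2
      exact h2
  · intro ζ w
    rw [ev_sec, ev_sec]
    have := congrArg (fun q => q.eval w) (hsec ζ)
    simpa using this

theorem rif_bez (h : IsRIF2 m n p pt) : ∃ d : ℂ[X], d ≠ 0 ∧
    ∀ ζ w : ℂ, ‖ζ‖ = 1 → ‖w‖ = 1 → d.eval ζ ≠ 0 → ev p (ζ, w) ≠ 0 := by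
  have hp : biv p ≠ 0 := by
    intro h0
    apply rif_sec_ne h (ζ := 1) (by simp)
    rw [h0]; simp [sec]
  obtain ⟨u, v, d, hd, huv⟩ := bez _ _ hp (rif_cop h)
  refine ⟨d, hd, fun ζ w hζ hw hdz h0 => hdz ?_⟩
  have hw0 : w ≠ 0 := by rintro rfl; simp at hw
  have h1 := rif_refl h hζ w hw0
  rw [conj_inv_of_norm hw, ← ev_sec p, h0, map_zero, mul_zero] at h1
  have := congrArg (fun f => (sec f ζ).eval w) huv
  simp only [sec, Polynomial.map_add, Polynomial.map_mul, eval_add, eval_mul, Polynomial.map_C,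
    eval_C, coe_evalRingHom] at this
  rw [ev_sec] at h0
  simp only [sec] at h0 h1
  rw [h0, h1, mul_zero, mul_zero, add_zero] at this
  exact this.symm

end

theorem e_an (t : ℝ) : AnalyticAt ℝ (fun t : ℝ => Complex.exp ((t : ℂ) * I)) t := by
  have h1 : AnalyticAt ℝ (fun t : ℝ => (t : ℂ) * I) t :=
    (ofRealCLM.analyticAt t).mul analyticAt_const
  have h2 : AnalyticAt ℝ Complex.exp ((t : ℂ) * I) :=
    (analyticAt_cexp (z := (t : ℂ) * I)).restrictScalars
  exact AnalyticAt.comp (g := Complex.exp) (f := fun t : ℝ => (t : ℂ) * I) h2 h1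

theorem e_arg {ζ : ℂ} (hζ : ‖ζ‖ = 1) : Complex.exp ((arg ζ : ℂ) * I) = ζ := by
  have := norm_mul_exp_arg_mul_I ζ
  rwa [hζ, ofReal_one, one_mul] at this

theorem e_sub (t : ℝ) (k : ℤ) :
    Complex.exp (((t - k • (2 * Real.pi) : ℝ) : ℂ) * I) = Complex.exp ((t : ℂ) * I) := by
  rw [Complex.exp_eq_exp_iff_exists_int]
  refine ⟨-k, ?_⟩
  push_cast
  simp
  ring

theorem e_mod (θ0 t : ℝ) :
    Complex.exp (((toIcoMod Real.two_pi_pos θ0 t : ℝ) : ℂ) * I) = Complex.exp ((t : ℂ) * I) :=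
  e_sub t _

theorem mod_arg (θ0 t : ℝ) : toIcoMod Real.two_pi_pos θ0 (arg (Complex.exp ((t : ℂ) * I))) =
    toIcoMod Real.two_pi_pos θ0 t := by
  rw [arg_exp_mul_I]
  simp

theorem param (n : ℕ) (R : ℂ[X][X]) (hR : ∀ ζ, ‖ζ‖ = 1 → Circ n (sec R ζ)) (θ0 : ℝ) :
    ∃ μ : Fin n → ℝ → ℂ, ∀ t ∈ Set.Icc θ0 (θ0 + 2 * Real.pi), (∀ j, AnalyticAt ℝ (μ j) t) ∧
      ∀ w, (sec R (Complex.exp ((t : ℂ) * I))).eval w = 0 ↔ ∃ j, w = μ j t := by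
  set e : ℝ → ℂ := fun t => Complex.exp ((t : ℂ) * I) with he
  have hpa : ∀ (d : ℂ[X]) (t : ℝ), AnalyticAt ℝ (fun t => d.eval (e t)) t := fun d t =>
    eval_an (A := fun _ => d) (d.natDegree + 1) (fun _ => analyticAt_const)
      (Eventually.of_forall fun _ => Nat.lt_succ_self _) (e_an t)
  have hlead : ∀ t, (R.coeff n).eval (e t) ≠ 0 := by
    intro t
    have h := hR (e t) (exp_norm t)
    have h2 : (sec R (e t)).leadingCoeff ≠ 0 := leadingCoeff_ne_zero.2 h.1
    rwa [leadingCoeff, h.2.1, sec_coeff] at h2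
  obtain ⟨μ, hμ⟩ := glob_all n θ0 (θ0 + 2 * Real.pi) (by linarith [Real.two_pi_pos])
    (fun t => C ((R.coeff n).eval (e t))⁻¹ * sec R (e t)) (by
      intro t _
      constructor
      · intro k
        simp only [coeff_C_mul, sec_coeff]
        exact ((hpa _ t).inv (hlead t)).mul (hpa _ t)
      · refine Eventually.of_forall fun s => ?_
        have h := hR (e s) (exp_norm s)
        refine ⟨?_, ?_, ?_⟩
        · rw [Monic, leadingCoeff_mul, leadingCoeff_C, leadingCoeff, h.2.1, sec_coeff,
            inv_mul_cancel₀ (hlead s)]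
        · rw [natDegree_C_mul (inv_ne_zero (hlead s)), h.2.1]
        · intro z hz
          refine h.2.2 z ?_
          rw [IsRoot, eval_mul, eval_C] at hz
          exact (mul_eq_zero.1 hz).resolve_left (inv_ne_zero (hlead s)))
  refine ⟨μ, fun t ht => ⟨(hμ t ht).1, fun w => ?_⟩⟩
  have h1 := (hμ t ht).2.self_of_nhds
  have h2 := congrArg (fun q => q.eval w) h1
  simp only [eval_mul, eval_C, eval_prod, eval_sub, eval_X] at h2
  have h3 : (sec R (e t)).eval w = 0 ↔ ((R.coeff n).eval (e t))⁻¹ * (sec R (e t)).eval w = 0 := by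
    simp [hlead t]
  rw [h3, h2, Finset.prod_eq_zero_iff]
  simp [sub_eq_zero]

theorem ev_cont (p : MvPolynomial (Fin 2) ℂ) : Continuous (ev p) := by
  have : ev p = fun z : ℂ × ℂ => (sec (biv p) z.1).eval z.2 := by
    funext z; exact ev_sec p z.1 z.2
  rw [this]; exact sec_cont _

/-- the radial limit set -/
def radSet (p pt : MvPolynomial (Fin 2) ℂ) (α : ℂ) : Set (ℂ × ℂ) := {ζ | ζ ∈ torus2 ∧
    Tendsto (fun r : ℝ => rif p pt ((r : ℂ) * ζ.1, (r : ℂ) * ζ.2)) (𝓝[<] (1 : ℝ)) (𝓝 α)}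

theorem radial (p : MvPolynomial (Fin 2) ℂ) (ζ : ℂ × ℂ) :
    Tendsto (fun r : ℝ => ev p ((r : ℂ) * ζ.1, (r : ℂ) * ζ.2)) (𝓝[<] (1 : ℝ)) (𝓝 (ev p ζ)) := by
  refine Tendsto.mono_left ?_ nhdsWithin_le_nhds
  have : Continuous fun r : ℝ => ev p ((r : ℂ) * ζ.1, (r : ℂ) * ζ.2) :=
    (ev_cont p).comp (by fun_prop)
  simpa using this.tendsto 1

theorem radSet_of (p pt : MvPolynomial (Fin 2) ℂ) (α : ℂ) (z : ℂ × ℂ) (hz : z ∈ torus2)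
    (hp : ev p z ≠ 0) (h0 : ev pt z - α * ev p z = 0) : z ∈ radSet p pt α := by
  refine ⟨hz, ?_⟩
  have := (radial pt z).div (radial p z) hp
  rw [sub_eq_zero.1 h0, mul_div_cancel_right₀ _ hp] at this
  exact this

theorem radSet_sub {m n : ℕ} {p pt : MvPolynomial (Fin 2) ℂ} (h : IsRIF2 m n p pt) (α : ℂ) :
    closure (radSet p pt α) ⊆ {z | z ∈ torus2 ∧ ev pt z - α * ev p z = 0} := by
  refine closure_minimal ?_ ?_
  · rintro z ⟨hz, hlim⟩
    refine ⟨hz, sub_eq_zero.2 ?_⟩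
    refine tendsto_nhds_unique_of_eventuallyEq (radial pt z) (hlim.mul (radial p z)) ?_
    have : ∀ᶠ r : ℝ in 𝓝[<] (1 : ℝ), 0 < r :=
      mem_nhdsWithin_of_mem_nhds (Ioi_mem_nhds one_pos)
    filter_upwards [self_mem_nhdsWithin, this] with r hr hr0
    have hne : ev p ((r : ℂ) * z.1, (r : ℂ) * z.2) ≠ 0 := by
      refine h.stable _ ⟨?_, ?_⟩
      · simp only [norm_mul, hz.1, norm_real, Real.norm_eq_abs, abs_of_pos hr0, mul_one]
        exact hr
      · simp only [norm_mul, hz.2, norm_real, Real.norm_eq_abs, abs_of_pos hr0, mul_one]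
        exact hr
    rw [rif, div_mul_cancel₀ _ hne]
  · have h1 : IsClosed (torus2) :=
      (isClosed_eq (continuous_fst.norm) continuous_const).inter
        (isClosed_eq (continuous_snd.norm) continuous_const)
    exact h1.inter (isClosed_eq ((ev_cont pt).sub (continuous_const.mul (ev_cont p)))
      continuous_const)

theorem main_aux
    (m n : ℕ) (p pt : MvPolynomial (Fin 2) ℂ) (hRIF : IsRIF2 m n p pt)
    (α : ℂ) (hα : ‖α‖ = 1) (τ₀ : ℂ) (hτ₀ : ‖τ₀‖ = 1) :
    ∃ g : Fin n → ℂ → ℂ,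
      (∀ j, ∀ ζ : ℂ, ‖ζ‖ = 1 → ‖g j ζ‖ = 1) ∧
      (∀ j, ∀ θ : ℝ, Complex.exp ((θ : ℂ) * Complex.I) ≠ τ₀ →
        AnalyticAt ℝ (fun t : ℝ => g j (Complex.exp ((t : ℂ) * Complex.I))) θ) ∧
      ∃ (k : ℕ) (τ : Fin k → ℂ), (∀ i, ‖τ i‖ = 1) ∧
        levelSet2 p pt α = graphUnion n g ∪ ⋃ i, vLine (τ i) := by
  obtain ⟨c, R, hc, hR, hfac⟩ := rif_fac hRIF hα
  obtain ⟨d, hd, hdp⟩ := rif_bez hRIF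
  set θ0 := arg τ₀ with hθ0
  obtain ⟨μ, hμ⟩ := param n R hR θ0
  set L : ℂ → ℝ := fun ζ => toIcoMod Real.two_pi_pos θ0 (arg ζ) with hL
  have hLm : ∀ ζ, L ζ ∈ Set.Ico θ0 (θ0 + 2 * Real.pi) := fun ζ => toIcoMod_mem_Ico _ _ _
  have hLe : ∀ ζ, ‖ζ‖ = 1 → Complex.exp ((L ζ : ℂ) * I) = ζ := by
    intro ζ hζ
    simp only [hL]
    rw [e_mod, e_arg hζ]
  have hroot : ∀ ζ, ‖ζ‖ = 1 → ∀ w, (sec R ζ).eval w = 0 ↔ ∃ j, w = μ j (L ζ) := by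
    intro ζ hζ w
    have := (hμ (L ζ) (Set.Ico_subset_Icc_self (hLm ζ))).2 w
    rwa [hLe ζ hζ] at this
  have hgn : ∀ j, ∀ ζ : ℂ, ‖ζ‖ = 1 → ‖μ j (L ζ)‖ = 1 := fun j ζ hζ =>
    (hR ζ hζ).2.2 _ ((hroot ζ hζ _).2 ⟨j, rfl⟩)
  classical
  set T : Finset ℂ := c.roots.toFinset.filter (fun z => ‖z‖ = 1) with hT
  have hTm : ∀ z, z ∈ T ↔ c.eval z = 0 ∧ ‖z‖ = 1 := by
    intro z
    simp [hT, hc]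
  refine ⟨fun j ζ => μ j (L ζ), hgn, ?_, T.card, fun i => (T.equivFin.symm i : ℂ), ?_, ?_⟩
  · intro j θ hθ
    simp only [hL, mod_arg]
    set k := toIcoDiv Real.two_pi_pos θ0 θ with hk
    have hmem := sub_toIcoDiv_zsmul_mem_Ico Real.two_pi_pos θ0 θ
    rw [← hk] at hmem
    have hne : θ0 ≠ θ - k • (2 * Real.pi) := by
      intro h
      apply hθ
      rw [← e_sub θ k, ← h, hθ0, e_arg hτ₀]
    have hlt : θ0 < θ - k • (2 * Real.pi) := lt_of_le_of_ne hmem.1 hne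
    have h1 : AnalyticAt ℝ (fun t : ℝ => μ j (t - k • (2 * Real.pi))) θ := by
      have h2 := (hμ _ (Set.Ico_subset_Icc_self hmem)).1 j
      have h3 : AnalyticAt ℝ (fun t : ℝ => t - k • (2 * Real.pi)) θ :=
        analyticAt_id.sub analyticAt_const
      exact AnalyticAt.comp (g := μ j) (f := fun t : ℝ => t - k • (2 * Real.pi)) h2 h3
    refine h1.congr ?_
    have hcont : ContinuousAt (fun t : ℝ => t - k • (2 * Real.pi)) θ := by fun_prop
    filter_upwards [hcont.preimage_mem_nhds (Ioo_mem_nhds hlt hmem.2)] with t ht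
    have h4 := toIcoDiv_eq_of_sub_zsmul_mem_Ico Real.two_pi_pos (Set.Ioo_subset_Ico_self ht)
    rw [toIcoMod, h4]
  · intro i
    exact ((hTm _).1 (T.equivFin.symm i).2).2
  · have hlev : levelSet2 p pt α = closure (radSet p pt α) := rfl
    have hlines : ∀ z : ℂ × ℂ, z ∈ (⋃ i, vLine (T.equivFin.symm i : ℂ)) ↔ z.1 ∈ T ∧ ‖z.2‖ = 1 := by
      intro z
      simp only [Set.mem_iUnion, vLine, Set.mem_ofPred_eq]
      constructor
      · rintro ⟨i, h1, h2⟩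
        rw [h1]
        exact ⟨(T.equivFin.symm i).2, h2⟩
      · rintro ⟨h1, h2⟩
        exact ⟨T.equivFin ⟨z.1, h1⟩, by simp, h2⟩
    rw [hlev]
    apply Set.Subset.antisymm
    · intro z hz
      obtain ⟨hzt, hz0⟩ := radSet_sub hRIF α hz
      rw [← Prod.mk.eta (p := z), hfac, mul_eq_zero] at hz0
      rcases hz0 with h | h
      · right
        exact (hlines z).2 ⟨(hTm _).2 ⟨h, hzt.1⟩, hzt.2⟩
      · left
        obtain ⟨j, hj⟩ := (hroot _ hzt.1 _).1 h
        exact Set.mem_iUnion.2 ⟨j, hzt.1, hj⟩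
    · rintro ⟨ζ, w⟩ (hz | hz)
      · obtain ⟨j, hζ, hw⟩ := Set.mem_iUnion.1 hz
        simp only at hζ hw
        set t := L ζ with ht
        have htm := hLm ζ
        rw [← ht] at htm
        have hcl : Tendsto (fun s : ℝ => (Complex.exp ((s : ℂ) * I), μ j s)) (𝓝[>] t)
            (𝓝 (ζ, w)) := by
          refine Tendsto.mono_left ?_ nhdsWithin_le_nhds
          have h1 := (e_an t).continuousAt.tendsto
          have h2 := ((hμ t (Set.Ico_subset_Icc_self htm)).1 j).continuousAt.tendsto
          rw [hLe ζ hζ] at h1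
          rw [← hw] at h2
          exact h1.prodMk_nhds h2
        refine mem_closure_of_tendsto hcl ?_
        have h3 : ∀ᶠ s in 𝓝[>] t, s < θ0 + 2 * Real.pi :=
          mem_nhdsWithin_of_mem_nhds (Iio_mem_nhds htm.2)
        have h4 : ∀ᶠ s : ℝ in 𝓝[>] t, d.eval (Complex.exp ((s : ℂ) * I)) ≠ 0 :=
          (poly_ne_exp d hd t).filter_mono (nhdsWithin_mono t (fun (s : ℝ) (hs : t < s) => (ne_of_gt hs : s ≠ t)))
        filter_upwards [h3, h4, self_mem_nhdsWithin] with s h5 h6 h7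
        have hs : s ∈ Set.Icc θ0 (θ0 + 2 * Real.pi) := ⟨htm.1.trans (le_of_lt h7), h5.le⟩
        have h8 := ((hμ s hs).2 (μ j s)).2 ⟨j, rfl⟩
        have h9 : ‖μ j s‖ = 1 := (hR _ (exp_norm s)).2.2 _ h8
        refine radSet_of p pt α _ ⟨exp_norm s, h9⟩ (hdp _ _ (exp_norm s) h9 h6) ?_
        rw [hfac, h8, mul_zero]
      · obtain ⟨h1, h2⟩ := (hlines _).1 hz
        obtain ⟨hcz, hζ⟩ := (hTm _).1 h1
        simp only at hcz hζ h2
        have hcl : Tendsto (fun s : ℝ => (ζ, Complex.exp ((s : ℂ) * I))) (𝓝[≠] (arg w))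
            (𝓝 (ζ, w)) := by
          refine Tendsto.mono_left ?_ nhdsWithin_le_nhds
          have h1 := (e_an (arg w)).continuousAt.tendsto
          rw [e_arg h2] at h1
          exact tendsto_const_nhds.prodMk_nhds h1
        refine mem_closure_of_tendsto hcl ?_
        filter_upwards [poly_ne_exp _ (rif_sec_ne hRIF hζ) (arg w)] with s hs
        refine radSet_of p pt α _ ⟨hζ, exp_norm s⟩ (by rw [ev_sec]; exact hs) ?_
        rw [hfac, hcz, zero_mul]

end

/-- Let `φ = p̃/p` be a bidegree `(m,n)` RIF on `𝔻²`. For each `α ∈ 𝕋`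
and any base point `τ₀ ∈ 𝕋`, there exist functions `g₁^α, …, g_n^α : 𝕋 → 𝕋`, analytic on
`𝕋 ∖ {τ₀}`, such that `C_α(φ)` is the union of their graphs, possibly together with
finitely many vertical lines `{ζ₁ = τ_i}`. -/
theorem levelSet_parameterization
    (m n : ℕ) (p pt : MvPolynomial (Fin 2) ℂ) (hRIF : IsRIF2 m n p pt)
    (α : ℂ) (hα : ‖α‖ = 1) (τ₀ : ℂ) (hτ₀ : ‖τ₀‖ = 1) :
    ∃ g : Fin n → ℂ → ℂ,
      (∀ j, ∀ ζ : ℂ, ‖ζ‖ = 1 → ‖g j ζ‖ = 1) ∧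
      (∀ j, ∀ θ : ℝ, Complex.exp ((θ : ℂ) * Complex.I) ≠ τ₀ →
        AnalyticAt ℝ (fun t : ℝ => g j (Complex.exp ((t : ℂ) * Complex.I))) θ) ∧
      ∃ (k : ℕ) (τ : Fin k → ℂ), (∀ i, ‖τ i‖ = 1) ∧
        levelSet2 p pt α = graphUnion n g ∪ ⋃ i, vLine (τ i) := by
  exact main_aux m n p pt hRIF α hα τ₀ hτ₀
end
end
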